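/- For the boundary driven Kawasaki process on 𝒢_N with N ≥ 5 and parameters satisfying μ_L > κ > 0 > μ_R and |μ_R| > κ, the unique stationary distribution ρ_β satisfies: lim_{β→∞} (1/β) log ρ_β(x) = 0 if and only if x = η_{p,q} for some p ≥ 3, q ≥ 2 with p+q = N; for every other configuration x there is α > 0 with lim_{β→∞} (1/β) log ρ_β(x) = −α. -/

import Mathlib

open scoped Classical

namespace Kawasaki

/-- Configurations of the lattice gas on `{1,…,N}`: each site is occupied (`true`) or empty. -/
abbrev Config (N : ℕ) := Fin N → Bool

/-- Occupation number of site `i` as a real number. -/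
noncomputable def occ {N : ℕ} (x : Config N) (i : Fin N) : ℝ := if x i then 1 else 0

/-- The nearest-neighbour interaction energy `E(x) = -κ ∑ x(i) x(i+1)`. -/
noncomputable def energy {N : ℕ} (κ : ℝ) (x : Config N) : ℝ :=
  -κ * ∑ i : Fin N, ∑ j : Fin N, if (j : ℕ) = (i : ℕ) + 1 then occ x i * occ x j else 0

/-- `x^{i,j}`: the configuration with the occupations of `i` and `j` interchanged. -/
def swapConf {N : ℕ} (x : Config N) (i j : Fin N) : Config N :=
  Function.update (Function.update x i (x j)) j (x i)

/-- `x^i`: the configuration with the occupation at `i` flipped. -/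
def flipConf {N : ℕ} (x : Config N) (i : Fin N) : Config N :=
  Function.update x i (!x i)

/-- The last site. -/
def lastIdx (N : ℕ) [NeZero N] : Fin N :=
  ⟨N - 1, Nat.sub_lt (Nat.pos_of_ne_zero (NeZero.ne N)) Nat.one_pos⟩

/-- `y` is obtained from `x` by exchanging the occupations of two nearest neighbours. -/
def IsSwap {N : ℕ} (x y : Config N) : Prop :=
  ∃ i j : Fin N, (j : ℕ) = (i : ℕ) + 1 ∧ y = swapConf x i j

/-- The allowed transitions: nearest-neighbour exchanges in the bulk,
birth/death at the two boundary sites. -/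
def Allowed {N : ℕ} [NeZero N] (x y : Config N) : Prop :=
  y ≠ x ∧ (IsSwap x y ∨ y = flipConf x 0 ∨ y = flipConf x (lastIdx N))

/-- The transition rates of the boundary driven Kawasaki process at inverse temperature `β`. -/
noncomputable def rate {N : ℕ} [NeZero N] (κ μL μR β : ℝ) (x y : Config N) : ℝ :=
  if y = x then 0
  else if IsSwap x y then Real.exp (-(β / 2) * (energy κ y - energy κ x))
  else if y = flipConf x 0 then
    Real.exp (β * μL / 2 * (1 - 2 * occ x 0)) *
      Real.exp (-(β / 2) * (energy κ y - energy κ x))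
  else if y = flipConf x (lastIdx N) then
    Real.exp (β * μR / 2 * (1 - 2 * occ x (lastIdx N))) *
      Real.exp (-(β / 2) * (energy κ y - energy κ x))
  else 0

/-- `ρ` is a stationary probability distribution for the rates at inverse temperature `β`. -/
noncomputable def IsStationary {N : ℕ} [NeZero N] (κ μL μR β : ℝ) (ρ : Config N → ℝ) : Prop :=
  (∀ x, 0 ≤ ρ x) ∧ (∑ x, ρ x = 1) ∧
  ∀ x, ∑ y, ρ y * rate κ μL μR β y x = ρ x * ∑ y, rate κ μL μR β x y

/-- `φ(x,y) = lim_{β→∞} (1/β) log k(x→y;β)` (computed explicitly, the rates being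
pure exponentials in `β`). -/
noncomputable def phi {N : ℕ} [NeZero N] (κ μL μR : ℝ) (x y : Config N) : ℝ :=
  if IsSwap x y then -(energy κ y - energy κ x) / 2
  else if y = flipConf x 0 then
    μL * (1 - 2 * occ x 0) / 2 - (energy κ y - energy κ x) / 2
  else if y = flipConf x (lastIdx N) then
    μR * (1 - 2 * occ x (lastIdx N)) / 2 - (energy κ y - energy κ x) / 2
  else 0

/-- `Γ(x) = -max_y φ(x,y)` (maximum over the allowed transitions from `x`). -/
noncomputable def Gam {N : ℕ} [NeZero N] (κ μL μR : ℝ) (x : Config N) : ℝ :=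
  - sSup (phi κ μL μR x '' {y | Allowed x y})

/-- `U(x,y) = -φ(x,y) - Γ(x)` (meaningful on allowed transitions). -/
noncomputable def Ucost {N : ℕ} [NeZero N] (κ μL μR : ℝ) (x y : Config N) : ℝ :=
  - phi κ μL μR x y - Gam κ μL μR x

/-- The cost `U(D)` of a path: sum of `U` over consecutive steps. -/
noncomputable def pathCost {N : ℕ} [NeZero N] (κ μL μR : ℝ) : List (Config N) → ℝ
  | [] => 0
  | [_] => 0
  | a :: b :: l => Ucost κ μL μR a b + pathCost κ μL μR (b :: l)

/-- `𝒰(x,y)`: the minimal cost over all paths of allowed transitions from `x` to `y`. -/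
noncomputable def Ucal {N : ℕ} [NeZero N] (κ μL μR : ℝ) (x y : Config N) : ℝ :=
  sInf { c | ∃ L : List (Config N), L.Chain' Allowed ∧ L.head? = some x ∧
    L.getLast? = some y ∧ c = pathCost κ μL μR L }

/-- `t` encodes a spanning tree of the transition graph with all edges oriented toward `x`:
`t y` is the successor of `y` on the unique path from `y` to the root `x`. -/
def IsInTree {N : ℕ} [NeZero N] (t : Config N → Config N) (x : Config N) : Prop :=
  t x = x ∧ (∀ y, y ≠ x → Allowed y (t y)) ∧ ∀ y, ∃ n : ℕ, t^[n] y = x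

/-- `U(𝒯_x)`: the sum of `U` over all (oriented) edges of the in-tree. -/
noncomputable def treeCost {N : ℕ} [NeZero N] (κ μL μR : ℝ) (t : Config N → Config N)
    (x : Config N) : ℝ :=
  ∑ y : Config N, if y = x then 0 else Ucost κ μL μR y (t y)

/-- `Θ(x) = min_𝒯 U(𝒯_x)`. -/
noncomputable def Theta {N : ℕ} [NeZero N] (κ μL μR : ℝ) (x : Config N) : ℝ :=
  sInf { c | ∃ t, IsInTree t x ∧ c = treeCost κ μL μR t x }

/-- `Ψ = Γ - Θ`. -/
noncomputable def Psi {N : ℕ} [NeZero N] (κ μL μR : ℝ) (x : Config N) : ℝ :=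
  Gam κ μL μR x - Theta κ μL μR x

/-- `η_{p,q}`: `p` occupied sites followed by `q = N - p` empty sites. -/
def eta (N p : ℕ) : Config N := fun i => decide ((i : ℕ) < p)

/-- `x ∈ 𝒟` iff `x = η_{p,q}` with `p ≥ 3`, `q ≥ 2`, `p + q = N`. -/
def memD {N : ℕ} (x : Config N) : Prop :=
  ∃ p q : ℕ, 3 ≤ p ∧ 2 ≤ q ∧ p + q = N ∧ x = eta N p

/-- The configuration written in block form `(p_0,q_0,…,p_n,q_n)`:
`p_0` occupied sites, then `q_0` empty sites, and so on. -/
def blockConfig (ps qs : List ℕ) : List Bool :=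
  (ps.zip qs).flatMap fun pq => List.replicate pq.1 true ++ List.replicate pq.2 false

/-- `x ∈ 𝒫`: block form `(p_0,q_0,…,p_n,q_n)` with all `p_i ≥ 3`,
`q_i ≥ 3` for `i < n` and `q_n ≥ 2`. -/
def memP {N : ℕ} (x : Config N) : Prop :=
  ∃ ps qs : List ℕ, ps.length = qs.length ∧ 0 < ps.length ∧
    (∀ p ∈ ps, 3 ≤ p) ∧ (∀ q ∈ qs.dropLast, 3 ≤ q) ∧ (∀ q ∈ qs.getLast?, 2 ≤ q) ∧
    List.ofFn x = blockConfig ps qs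

/-- `y` is obtained from `x` by one occupation switch of the form
`…11100… → …11010…` or `…00111… → …01011…`. -/
def isSwitchE {N : ℕ} (x y : Config N) : Prop :=
  (∃ a : ℕ, ∃ h : a + 4 < N,
    x ⟨a, by omega⟩ = true ∧ x ⟨a + 1, by omega⟩ = true ∧ x ⟨a + 2, by omega⟩ = true ∧
    x ⟨a + 3, by omega⟩ = false ∧ x ⟨a + 4, by omega⟩ = false ∧
    y = swapConf x ⟨a + 2, by omega⟩ ⟨a + 3, by omega⟩) ∨
  (∃ a : ℕ, ∃ h : a + 4 < N,
    x ⟨a, by omega⟩ = false ∧ x ⟨a + 1, by omega⟩ = false ∧ x ⟨a + 2, by omega⟩ = true ∧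
    x ⟨a + 3, by omega⟩ = true ∧ x ⟨a + 4, by omega⟩ = true ∧
    y = swapConf x ⟨a + 1, by omega⟩ ⟨a + 2, by omega⟩)

/-- `y ∈ ℰ`: obtained from some `x ∈ 𝒫` by one such switch. -/
def memE {N : ℕ} (y : Config N) : Prop := ∃ x : Config N, memP x ∧ isSwitchE x y

/-- `y` is a preferred successor of `x`: an allowed transition with `U(x,y) = 0`. -/
def PreferredStep {N : ℕ} [NeZero N] (κ μL μR : ℝ) (x y : Config N) : Prop :=
  Allowed x y ∧ Ucost κ μL μR x y = 0

/-- `𝒜_x`: the set consisting of `x` together with all its preferred successors. -/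
def Attr {N : ℕ} [NeZero N] (κ μL μR : ℝ) (x : Config N) : Set (Config N) :=
  insert x {y | PreferredStep κ μL μR x y}

/-- A nonempty set `A` is an attractor when `𝒰 = 0` inside `A` and `𝒰 > 0` from `A`
to its complement. -/
def IsAttractor {N : ℕ} [NeZero N] (κ μL μR : ℝ) (A : Set (Config N)) : Prop :=
  A.Nonempty ∧ (∀ x ∈ A, ∀ y ∈ A, x ≠ y → Ucal κ μL μR x y = 0) ∧
  ∀ x ∈ A, ∀ y, y ∉ A → 0 < Ucal κ μL μR x y

end Kawasaki

namespace MarkovChain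

open Filter Topology

variable {V : Type*} [Fintype V]

/-- The balance equations for a signed measure `u`. -/
def Balanced (k : V → V → ℝ) (u : V → ℝ) : Prop :=
  ∀ x, ∑ y, u y * k y x = u x * ∑ y, k x y

/-- Every nonempty set closed under taking predecessors is everything. -/
def Irred (k : V → V → ℝ) : Prop :=
  ∀ A : Set V, A.Nonempty → (∀ y ∈ A, ∀ x, 0 < k x y → x ∈ A) → A = Set.univ

theorem Balanced.eq_zero_of_nonneg {k : V → V → ℝ} {u : V → ℝ} (hk : ∀ x y, 0 ≤ k x y)
    (hirr : Irred k) (hu : Balanced k u) (h0 : ∀ x, 0 ≤ u x) {z : V} (hz : u z = 0) (x : V) :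
    u x = 0 := by
  have h : {x | u x = 0} = Set.univ := by
    refine hirr _ ⟨z, hz⟩ fun y hy x hxy => ?_
    have h1 := hu y
    rw [show u y = 0 from hy, zero_mul,
      Finset.sum_eq_zero_iff_of_nonneg fun i _ => mul_nonneg (h0 i) (hk i y)] at h1
    exact (mul_eq_zero.1 (h1 x (Finset.mem_univ x))).resolve_right hxy.ne'
  exact Set.eq_univ_iff_forall.1 h x

theorem Balanced.pos {k : V → V → ℝ} {u : V → ℝ} (hk : ∀ x y, 0 ≤ k x y)
    (hirr : Irred k) (hu : Balanced k u) (h0 : ∀ x, 0 ≤ u x) (h1 : ∑ x, u x = 1) (x : V) :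
    0 < u x := by
  refine lt_of_le_of_ne (h0 x) fun h => ?_
  simp [hu.eq_zero_of_nonneg hk hirr h0 h.symm] at h1

theorem Balanced.eq_zero_of_sum_eq_zero {k : V → V → ℝ} {u w : V → ℝ} (hk : ∀ x y, 0 ≤ k x y)
    (hirr : Irred k) (hu : Balanced k u) (h0 : ∀ x, 0 ≤ u x) (h1 : ∑ x, u x = 1)
    (hw : Balanced k w) (hw0 : ∑ x, w x = 0) (x : V) : w x = 0 := by
  have hpos := hu.pos hk hirr h0 h1
  obtain ⟨z, -, hz⟩ := Finset.exists_min_image Finset.univ (fun y => w y / u y)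
    ⟨x, Finset.mem_univ x⟩
  set c := w z / u z with hc
  have hb : Balanced k (fun y => w y - c * u y) := by
    intro y
    have e1 := hu y
    have e2 := hw y
    calc ∑ a, (w a - c * u a) * k a y = ∑ a, w a * k a y - c * ∑ a, u a * k a y := by
          rw [Finset.mul_sum, ← Finset.sum_sub_distrib]
          exact Finset.sum_congr rfl fun a _ => by ring
      _ = _ := by rw [e1, e2]; ring
  have hnn : ∀ y, 0 ≤ w y - c * u y := fun y => by
    have := hz y (Finset.mem_univ y)
    rw [le_div_iff₀ (hpos y)] at this
    linarith
  have hzero : w z - c * u z = 0 := by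
    rw [hc, div_mul_cancel₀ _ (hpos z).ne', sub_self]
  have hall := hb.eq_zero_of_nonneg hk hirr hnn hzero
  have hcc : c = 0 := by
    have : ∑ y, (w y - c * u y) = 0 := Finset.sum_eq_zero fun y _ => hall y
    rw [Finset.sum_sub_distrib, ← Finset.mul_sum, hw0, h1] at this
    linarith
  have := hall x
  rw [hcc] at this
  linarith

/-- The transposed generator with the row of `z` replaced by ones. -/
noncomputable def sysMatrix {R : Type*} [CommRing R] (k : V → V → R) (z : V) : Matrix V V R :=
  Matrix.of fun x y => if x = z then 1 else k y x - if x = y then ∑ w, k x w else 0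

theorem sysMatrix_mulVec_of_ne (k : V → V → ℝ) (u : V → ℝ) {z x : V} (h : x ≠ z) :
    (sysMatrix k z).mulVec u x = ∑ y, u y * k y x - u x * ∑ y, k x y := by
  simp only [Matrix.mulVec, dotProduct, sysMatrix, Matrix.of_apply, if_neg h, sub_mul,
    Finset.sum_sub_distrib, ite_mul, zero_mul, Finset.sum_ite_eq, Finset.mem_univ, if_true]
  rw [mul_comm (u x)]
  congr 1
  exact Finset.sum_congr rfl fun y _ => mul_comm _ _

theorem sysMatrix_mulVec_self (k : V → V → ℝ) (u : V → ℝ) (z : V) :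
    (sysMatrix k z).mulVec u z = ∑ y, u y := by
  simp [Matrix.mulVec, dotProduct, sysMatrix]

theorem sysMatrix_det_ne_zero {k : V → V → ℝ} {u : V → ℝ} (hk : ∀ x y, 0 ≤ k x y)
    (hirr : Irred k) (hu : Balanced k u) (h0 : ∀ x, 0 ≤ u x) (h1 : ∑ x, u x = 1) (z : V) :
    (sysMatrix k z).det ≠ 0 := by
  intro hdet
  obtain ⟨w, hw, hMw⟩ := Matrix.exists_mulVec_eq_zero_iff.2 hdet
  apply hw
  have hs : ∑ y, w y = 0 := by rw [← sysMatrix_mulVec_self k w z, hMw]; rfl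
  have hne : ∀ x, x ≠ z → ∑ y, w y * k y x - w x * ∑ y, k x y = 0 := fun x hx => by
    rw [← sysMatrix_mulVec_of_ne k w hx, hMw]; rfl
  have htot : ∑ x, (∑ y, w y * k y x - w x * ∑ y, k x y) = 0 := by
    rw [Finset.sum_sub_distrib, Finset.sum_comm, sub_eq_zero]
    exact Finset.sum_congr rfl fun x _ => by rw [Finset.mul_sum]
  have hb : Balanced k w := by
    intro x
    by_cases hx : x = z
    · rw [Finset.sum_eq_single z (fun b _ hb => hne b hb) (by simp)] at htot
      rw [hx]; linarith
    · linarith [hne x hx]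
  exact funext fun x => hu.eq_zero_of_sum_eq_zero hk hirr h0 h1 hb hs x

theorem sysMatrix_mulVec_eq_single {k : V → V → ℝ} {u : V → ℝ} (hu : Balanced k u)
    (h1 : ∑ x, u x = 1) (z : V) : (sysMatrix k z).mulVec u = Pi.single z 1 := by
  funext x
  by_cases hx : x = z
  · rw [hx, sysMatrix_mulVec_self, h1, Pi.single_eq_same]
  · rw [sysMatrix_mulVec_of_ne k u hx, hu x, sub_self, Pi.single_eq_of_ne hx]

theorem det_mul_eq_adjugate {k : V → V → ℝ} {u : V → ℝ} (hu : Balanced k u)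
    (h1 : ∑ x, u x = 1) (z x : V) :
    (sysMatrix k z).det * u x = (sysMatrix k z).adjugate x z := by
  have h := congrArg ((sysMatrix k z).adjugate.mulVec) (sysMatrix_mulVec_eq_single hu h1 z)
  rw [Matrix.mulVec_mulVec, Matrix.adjugate_mul, Matrix.smul_mulVec, Matrix.one_mulVec] at h
  have := congrFun h x
  simpa using this

/-- Evaluation of a formal exponential sum `∑ c_a e^{a β}` at `β`. -/
noncomputable def expEval (β : ℝ) : AddMonoidAlgebra ℝ ℝ →+* ℝ :=
  (AddMonoidAlgebra.lift ℝ ℝ ℝ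
    { toFun := fun a => Real.exp (a.toAdd * β)
      map_one' := by simp
      map_mul' := fun a b => by simp [add_mul, Real.exp_add] }).toRingHom

theorem expEval_apply (β : ℝ) (p : AddMonoidAlgebra ℝ ℝ) :
    expEval β p = ∑ a ∈ p.coeff.support, p.coeff a * Real.exp (a * β) := by
  simp [expEval, AddMonoidAlgebra.lift_apply, Finsupp.sum]

theorem expEval_single (β a : ℝ) :
    expEval β (AddMonoidAlgebra.single a 1) = Real.exp (a * β) := by
  simp [expEval]

end MarkovChain

namespace MarkovChain

open Filter Topology

/-- A nonzero exponential sum has a logarithmic growth rate. -/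
theorem exists_tendsto_log_expEval {p : AddMonoidAlgebra ℝ ℝ} (hp : p ≠ 0) :
    ∃ a, Tendsto (fun β => Real.log |expEval β p| / β) atTop (𝓝 a) := by
  have hs : p.coeff.support.Nonempty := by
    rw [Finset.nonempty_iff_ne_empty]
    intro h
    apply hp
    rw [Finsupp.support_eq_empty] at h
    ext a
    simp [h]
  set m := p.coeff.support.max' hs with hm
  have hmem : m ∈ p.coeff.support := Finset.max'_mem _ _
  have hc : p.coeff m ≠ 0 := Finsupp.mem_support_iff.1 hmem
  have hlim : Tendsto (fun β => ∑ a ∈ p.coeff.support, p.coeff a * Real.exp ((a - m) * β)) atTop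
      (𝓝 (p.coeff m)) := by
    have : p.coeff m = ∑ a ∈ p.coeff.support, if a = m then p.coeff m else 0 := by
      rw [Finset.sum_ite_eq', if_pos hmem]
    rw [this]
    refine tendsto_finsetSum _ fun a ha => ?_
    by_cases h : a = m
    · simp [h]
    · rw [if_neg h]
      have hlt : a - m < 0 := sub_neg.2 (lt_of_le_of_ne (Finset.le_max' _ _ ha) h)
      have := (Real.tendsto_exp_atBot.comp (tendsto_id.const_mul_atTop_of_neg hlt)).const_mul
        (p.coeff a)
      simpa using this
  have hfac : ∀ β, expEval β p =
      Real.exp (m * β) * ∑ a ∈ p.coeff.support, p.coeff a * Real.exp ((a - m) * β) := by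
    intro β
    rw [expEval_apply, Finset.mul_sum]
    refine Finset.sum_congr rfl fun a _ => ?_
    rw [mul_left_comm, ← Real.exp_add]
    ring_nf
  have hlog := (hlim.abs.log (abs_pos.2 hc).ne').div_atTop tendsto_id
  refine ⟨m, ?_⟩
  have h2 : Tendsto (fun β => m + Real.log |∑ a ∈ p.coeff.support,
      p.coeff a * Real.exp ((a - m) * β)| / β) atTop (𝓝 (m + 0)) := hlog.const_add m
  rw [add_zero] at h2
  refine h2.congr' ?_
  filter_upwards [eventually_gt_atTop 0, hlim.eventually_ne hc] with β hβ hne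
  rw [hfac, abs_mul, abs_of_pos (Real.exp_pos _),
    Real.log_mul (Real.exp_pos _).ne' (abs_pos.2 hne).ne', Real.log_exp,
    add_div, mul_div_cancel_right₀ _ hβ.ne']

variable {V : Type*} [Fintype V]

theorem sysMatrix_map {R S : Type*} [CommRing R] [CommRing S] (f : R →+* S) (k : V → V → R)
    (z : V) : f.mapMatrix (sysMatrix k z) = sysMatrix (fun x y => f (k x y)) z := by
  ext x y
  simp only [sysMatrix, RingHom.mapMatrix_apply, Matrix.map_apply, Matrix.of_apply]
  split_ifs <;> simp

/-- The stationary probabilities of a chain with rates `k` that are exponential sums in `β`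
have logarithmic limits. -/
theorem exists_tendsto_log (K : V → V → AddMonoidAlgebra ℝ ℝ) (ρ : ℝ → V → ℝ)
    (hk : ∀ β, ∀ x y, 0 ≤ expEval β (K x y))
    (hirr : ∀ β, Irred fun x y => expEval β (K x y))
    (hb : ∀ β, 0 < β → Balanced (fun x y => expEval β (K x y)) (ρ β))
    (h0 : ∀ β, 0 < β → ∀ x, 0 ≤ ρ β x) (h1 : ∀ β, 0 < β → ∑ x, ρ β x = 1) (x : V) :
    ∃ a, Tendsto (fun β => Real.log (ρ β x) / β) atTop (𝓝 a) := by
  set D := (sysMatrix K x).det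
  set A := (sysMatrix K x).adjugate x x
  have hD : ∀ β, expEval β D = (sysMatrix (fun y z => expEval β (K y z)) x).det := fun β => by
    rw [RingHom.map_det, sysMatrix_map]
  have hA : ∀ β, expEval β A = (sysMatrix (fun y z => expEval β (K y z)) x).adjugate x x :=
    fun β => by
      rw [← sysMatrix_map, ← RingHom.map_adjugate]; rfl
  have hDne : ∀ β, 0 < β → expEval β D ≠ 0 := fun β hβ => by
    rw [hD]; exact sysMatrix_det_ne_zero (hk β) (hirr β) (hb β hβ) (h0 β hβ) (h1 β hβ) x
  have hpos : ∀ β, 0 < β → 0 < ρ β x := fun β hβ =>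
    (hb β hβ).pos (hk β) (hirr β) (h0 β hβ) (h1 β hβ) x
  have hmul : ∀ β, 0 < β → expEval β D * ρ β x = expEval β A := fun β hβ => by
    rw [hD, hA]; exact det_mul_eq_adjugate (hb β hβ) (h1 β hβ) x x
  have hAne : ∀ β, 0 < β → expEval β A ≠ 0 := fun β hβ => by
    rw [← hmul β hβ]; exact mul_ne_zero (hDne β hβ) (hpos β hβ).ne'
  obtain ⟨a, ha⟩ := exists_tendsto_log_expEval (p := A)
    fun h => hAne 1 one_pos (by rw [h, map_zero])
  obtain ⟨d, hd⟩ := exists_tendsto_log_expEval (p := D)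
    fun h => hDne 1 one_pos (by rw [h, map_zero])
  refine ⟨a - d, (ha.sub hd).congr' ?_⟩
  filter_upwards [eventually_gt_atTop 0] with β hβ
  rw [← hmul β hβ, abs_mul, Real.log_mul (abs_pos.2 (hDne β hβ)).ne'
    (abs_pos.2 (hpos β hβ).ne').ne',
    abs_of_pos (hpos β hβ)]
  ring

/-- If the logarithmic rates of a family of probability vectors exist, one of them vanishes. -/
theorem exists_rate_eq_zero [Nonempty V] {ρ : ℝ → V → ℝ} {v : V → ℝ}
    (hpos : ∀ β, 0 < β → ∀ x, 0 < ρ β x) (h1 : ∀ β, 0 < β → ∑ x, ρ β x = 1)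
    (hv : ∀ x, Tendsto (fun β => Real.log (ρ β x) / β) atTop (𝓝 (v x))) :
    (∀ x, v x ≤ 0) ∧ ∃ x, v x = 0 := by
  have hle : ∀ x, v x ≤ 0 := fun x => by
    refine le_of_tendsto (hv x) ?_
    filter_upwards [eventually_gt_atTop 0] with β hβ
    refine div_nonpos_of_nonpos_of_nonneg (Real.log_nonpos (hpos β hβ x).le ?_) hβ.le
    rw [← h1 β hβ]
    exact Finset.single_le_sum (fun y _ => (hpos β hβ y).le) (Finset.mem_univ x)
  refine ⟨hle, ?_⟩
  by_contra! hne
  have hlt : ∀ x, v x < 0 := fun x => lt_of_le_of_ne (hle x) (hne x)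
  have hz : ∀ x, Tendsto (fun β => ρ β x) atTop (𝓝 0) := fun x => by
    have h2 := Real.tendsto_exp_atBot.comp ((hv x).neg_mul_atTop (hlt x) tendsto_id)
    refine h2.congr' ?_
    filter_upwards [eventually_gt_atTop 0] with β hβ
    simp only [Function.comp, id]
    rw [div_mul_cancel₀ _ hβ.ne', Real.exp_log (hpos β hβ x)]
  have hs : Tendsto (fun β => ∑ x, ρ β x) atTop (𝓝 (∑ _x : V, (0 : ℝ))) :=
    tendsto_finsetSum _ fun x _ => hz x
  rw [Finset.sum_const_zero] at hs
  have : Tendsto (fun _ : ℝ => (1 : ℝ)) atTop (𝓝 0) := hs.congr' <| by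
    filter_upwards [eventually_gt_atTop 0] with β hβ using h1 β hβ
  exact one_ne_zero (tendsto_nhds_unique tendsto_const_nhds this)

/-- Flux balance across the boundary of a set. -/
theorem Balanced.flux {k : V → V → ℝ} {u : V → ℝ} (hu : Balanced k u) (A : Set V) :
    ∑ x, ∑ y, (if x ∈ A ∧ y ∉ A then u x * k x y else 0) =
      ∑ x, ∑ y, (if x ∉ A ∧ y ∈ A then u x * k x y else 0) := by
  have h : ∑ x, (if x ∈ A then u x * ∑ y, k x y else 0) =
      ∑ x, if x ∈ A then ∑ y, u y * k y x else 0 :=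
    Finset.sum_congr rfl fun x _ => by rw [hu x]
  have e1 : ∑ x, (if x ∈ A then u x * ∑ y, k x y else 0) =
      ∑ x, ∑ y, (if x ∈ A ∧ y ∈ A then u x * k x y else 0) +
      ∑ x, ∑ y, (if x ∈ A ∧ y ∉ A then u x * k x y else 0) := by
    rw [← Finset.sum_add_distrib]
    refine Finset.sum_congr rfl fun x _ => ?_
    rw [← Finset.sum_add_distrib]
    by_cases hx : x ∈ A
    · simp only [hx, if_true, true_and, Finset.mul_sum]
      refine Finset.sum_congr rfl fun y _ => ?_
      by_cases hy : y ∈ A <;> simp [hy]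
    · simp [hx]
  have e2 : ∑ x, (if x ∈ A then ∑ y, u y * k y x else 0) =
      ∑ x, ∑ y, (if x ∈ A ∧ y ∈ A then u x * k x y else 0) +
      ∑ x, ∑ y, (if x ∉ A ∧ y ∈ A then u x * k x y else 0) := by
    rw [← Finset.sum_add_distrib]
    have : ∀ x, (if x ∈ A then ∑ y, u y * k y x else 0) =
        ∑ y, if x ∈ A then u y * k y x else 0 := fun x => by
      by_cases hx : x ∈ A <;> simp [hx]
    simp only [this]
    rw [Finset.sum_comm]
    refine Finset.sum_congr rfl fun x _ => ?_
    rw [← Finset.sum_add_distrib]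
    refine Finset.sum_congr rfl fun y _ => ?_
    by_cases hx : x ∈ A <;> by_cases hy : y ∈ A <;> simp [hx, hy]
  linarith [h, e1, e2]

/-- Logarithmic form of the flux balance across a cut. -/
theorem exists_edge_ge {ρ : ℝ → V → ℝ} {v : V → ℝ} {k : ℝ → V → V → ℝ} {E : V → V → Prop}
    {φ : V → V → ℝ} (hk : ∀ β x y, k β x y = if E x y then Real.exp (φ x y * β) else 0)
    (hb : ∀ β, 0 < β → Balanced (k β) (ρ β)) (hpos : ∀ β, 0 < β → ∀ x, 0 < ρ β x)
    (hv : ∀ x, Tendsto (fun β => Real.log (ρ β x) / β) atTop (𝓝 (v x)))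
    {A : Set V} {x y : V} (hx : x ∈ A) (hy : y ∉ A) (hxy : E x y) :
    ∃ x' y', x' ∉ A ∧ y' ∈ A ∧ E x' y' ∧ v x + φ x y ≤ v x' + φ x' y' := by
  by_contra! hcon
  have hterm : ∀ a b, Tendsto (fun β => (if a ∉ A ∧ b ∈ A then ρ β a * k β a b else 0) /
      (ρ β x * k β x y)) atTop (𝓝 0) := by
    intro a b
    by_cases hab : (a ∉ A ∧ b ∈ A) ∧ E a b
    · obtain ⟨⟨ha, hb'⟩, hE⟩ := hab
      have hlt := hcon a b ha hb' hE
      have h1 := ((hv a).sub (hv x)).add_const (φ a b - φ x y)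
      have h2 := Real.tendsto_exp_atBot.comp
        (h1.neg_mul_atTop (by linarith) tendsto_id)
      refine h2.congr' ?_
      filter_upwards [eventually_gt_atTop 0] with β hβ
      simp only [Function.comp, id, hk, if_pos hE, if_pos hxy, ha, hb', not_false_eq_true,
        and_self, if_true]
      have : (Real.log (ρ β a) / β - Real.log (ρ β x) / β + (φ a b - φ x y)) * β =
          (Real.log (ρ β a) + φ a b * β) - (Real.log (ρ β x) + φ x y * β) := by
        field_simp
        ring
      rw [this, Real.exp_sub, Real.exp_add, Real.exp_add, Real.exp_log (hpos β hβ a),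
        Real.exp_log (hpos β hβ x)]
    · have : ∀ β, (if a ∉ A ∧ b ∈ A then ρ β a * k β a b else 0) = 0 := fun β => by
        rw [hk]
        split_ifs with h1 h2
        · exact absurd ⟨h1, h2⟩ hab
        · simp
        · rfl
      simp [this]
  have hsum : Tendsto (fun β => ∑ a, ∑ b, (if a ∉ A ∧ b ∈ A then ρ β a * k β a b else 0) /
      (ρ β x * k β x y)) atTop (𝓝 (∑ _a : V, ∑ _b : V, (0 : ℝ))) :=
    tendsto_finsetSum _ fun a _ => tendsto_finsetSum _ fun b _ => hterm a b
  simp only [Finset.sum_const_zero] at hsum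
  have hge : (1 : ℝ) ≤ 0 := by
    refine ge_of_tendsto hsum ?_
    filter_upwards [eventually_gt_atTop 0] with β hβ
    simp only [← Finset.sum_div]
    have hkn : ∀ a b, 0 ≤ k β a b := fun a b => by
      rw [hk]; split_ifs <;> positivity
    have hp : 0 < ρ β x * k β x y := by
      rw [hk, if_pos hxy]; exact mul_pos (hpos β hβ x) (Real.exp_pos _)
    rw [one_le_div hp, ← (hb β hβ).flux A]
    have hnn : ∀ a b, 0 ≤ if a ∈ A ∧ b ∉ A then ρ β a * k β a b else 0 := fun a b => by
      split_ifs
      · exact mul_nonneg (hpos β hβ a).le (hkn a b)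
      · rfl
    calc ρ β x * k β x y = if x ∈ A ∧ y ∉ A then ρ β x * k β x y else 0 := by simp [hx, hy]
      _ ≤ ∑ b, if x ∈ A ∧ b ∉ A then ρ β x * k β x b else 0 :=
        Finset.single_le_sum (f := fun b => if x ∈ A ∧ b ∉ A then ρ β x * k β x b else 0)
          (fun b _ => hnn x b) (Finset.mem_univ y)
      _ ≤ _ := Finset.single_le_sum
        (f := fun a => ∑ b, if a ∈ A ∧ b ∉ A then ρ β a * k β a b else 0)
        (fun a _ => Finset.sum_nonneg fun b _ => hnn a b) (Finset.mem_univ x)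
  linarith

end MarkovChain

namespace Kawasaki

variable {N : ℕ}

/-- Site `n` (numbered from `1` to `N`) is occupied; sites outside the lattice are empty. -/
def Occ (x : Config N) (n : ℕ) : Prop := ∃ h : n - 1 < N, 1 ≤ n ∧ x ⟨n - 1, h⟩ = true

/-- The configuration whose occupied sites are those satisfying `p`. -/
noncomputable def ofPred (N : ℕ) (p : ℕ → Prop) : Config N := fun i => decide (p (i + 1))

theorem Occ.bounds {x : Config N} {n : ℕ} (h : Occ x n) : 1 ≤ n ∧ n ≤ N := by
  obtain ⟨h1, h2, -⟩ := h
  omega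

theorem occ_ofPred (p : ℕ → Prop) (n : ℕ) : Occ (ofPred N p) n ↔ (1 ≤ n ∧ n ≤ N) ∧ p n := by
  constructor
  · rintro ⟨h1, h2, h3⟩
    simp only [ofPred, decide_eq_true_eq, Nat.sub_add_cancel h2] at h3
    exact ⟨⟨h2, by omega⟩, h3⟩
  · rintro ⟨⟨h1, h2⟩, h3⟩
    refine ⟨by omega, h1, ?_⟩
    simpa only [ofPred, decide_eq_true_eq, Nat.sub_add_cancel h1] using h3

theorem occ_succ_iff (x : Config N) (i : Fin N) : Occ x (i + 1) ↔ x i = true := by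
  simp [Occ]

theorem ext_occ {x y : Config N} (h : ∀ n, 1 ≤ n → n ≤ N → (Occ x n ↔ Occ y n)) : x = y := by
  funext i
  have := h (i + 1) (by omega) (by omega)
  rw [occ_succ_iff, occ_succ_iff] at this
  exact Bool.eq_iff_iff.2 this

/-- Exchange of sites `j` and `j + 1`. -/
noncomputable def sw (j : ℕ) (x : Config N) : Config N :=
  ofPred N fun n => if n = j then Occ x (j + 1) else if n = j + 1 then Occ x j else Occ x n

/-- Flip of the first site. -/
noncomputable def fl (x : Config N) : Config N :=
  ofPred N fun n => if n = 1 then ¬ Occ x 1 else Occ x n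

/-- Flip of the last site. -/
noncomputable def fr (x : Config N) : Config N :=
  ofPred N fun n => if n = N then ¬ Occ x N else Occ x n

theorem occ_sw (j : ℕ) (x : Config N) (n : ℕ) : Occ (sw j x) n ↔ (1 ≤ n ∧ n ≤ N) ∧
    if n = j then Occ x (j + 1) else if n = j + 1 then Occ x j else Occ x n := occ_ofPred _ _

theorem occ_fl (x : Config N) (n : ℕ) : Occ (fl x) n ↔ (1 ≤ n ∧ n ≤ N) ∧
    if n = 1 then ¬ Occ x 1 else Occ x n := occ_ofPred _ _

theorem occ_fr (x : Config N) (n : ℕ) : Occ (fr x) n ↔ (1 ≤ n ∧ n ≤ N) ∧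
    if n = N then ¬ Occ x N else Occ x n := occ_ofPred _ _

/-- Sites `j` and `j + 1` of the lattice carry different occupations. -/
def Iface (j : ℕ) (x : Config N) : Prop := 1 ≤ j ∧ j + 1 ≤ N ∧ (Occ x j ↔ ¬ Occ x (j + 1))

theorem swapConf_eq (x : Config N) (i j : Fin N) (h : (j : ℕ) = i + 1) :
    swapConf x i j = sw (i + 1) x := by
  refine ext_occ fun n h1 h2 => ?_
  obtain ⟨m, rfl⟩ : ∃ m, n = m + 1 := ⟨n - 1, by omega⟩
  rw [occ_sw, occ_succ_iff _ (⟨m, by omega⟩ : Fin N)]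
  have hj : Occ x (i + 1 + 1) ↔ x j = true := by rw [← h, occ_succ_iff]
  have hm := occ_succ_iff x (⟨m, by omega⟩ : Fin N)
  simp only [swapConf, Function.update_apply, Fin.ext_iff, hj, occ_succ_iff x i]
  simp only at hm
  rw [hm]
  grind

theorem flipConf_zero [NeZero N] (x : Config N) : flipConf x 0 = fl x := by
  refine ext_occ fun n h1 h2 => ?_
  obtain ⟨m, rfl⟩ : ∃ m, n = m + 1 := ⟨n - 1, by omega⟩
  have hm := occ_succ_iff x (⟨m, by omega⟩ : Fin N)
  have h0 := occ_succ_iff x (0 : Fin N)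
  rw [occ_fl, occ_succ_iff _ (⟨m, by omega⟩ : Fin N)]
  simp only [flipConf, Function.update_apply, Fin.ext_iff, Fin.val_zero, zero_add] at *
  rw [hm, h0]
  grind

theorem flipConf_last [NeZero N] (x : Config N) : flipConf x (lastIdx N) = fr x := by
  refine ext_occ fun n h1 h2 => ?_
  obtain ⟨m, rfl⟩ : ∃ m, n = m + 1 := ⟨n - 1, by omega⟩
  have hm := occ_succ_iff x (⟨m, by omega⟩ : Fin N)
  have h0 := occ_succ_iff x (lastIdx N)
  have hl : ((lastIdx N : Fin N) : ℕ) + 1 = N := by simp only [lastIdx]; omega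
  rw [hl] at h0
  rw [occ_fr, occ_succ_iff _ (⟨m, by omega⟩ : Fin N)]
  simp only [flipConf, Function.update_apply, Fin.ext_iff] at *
  rw [hm, h0]
  grind

theorem sw_eq_self {j : ℕ} {x : Config N} (h : Occ x j ↔ Occ x (j + 1)) : sw j x = x := by
  refine ext_occ fun n h1 h2 => ?_
  rw [occ_sw]
  grind

theorem sw_ne_self {j : ℕ} {x : Config N} (h : Iface j x) : sw j x ≠ x := by
  intro he
  have := occ_sw j x j
  rw [he] at this
  obtain ⟨h1, h2, h3⟩ := h
  grind

theorem fl_ne_self (hN : 1 ≤ N) (x : Config N) : fl x ≠ x := by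
  intro he
  have := occ_fl x 1
  rw [he] at this
  grind

theorem fr_ne_self (hN : 1 ≤ N) (x : Config N) : fr x ≠ x := by
  intro he
  have := occ_fr x N
  rw [he] at this
  grind

theorem isSwap_iff {x y : Config N} : IsSwap x y ↔ ∃ j, 1 ≤ j ∧ j + 1 ≤ N ∧ y = sw j x := by
  constructor
  · rintro ⟨i, j, h, rfl⟩
    exact ⟨i + 1, by omega, by omega, swapConf_eq x i j h⟩
  · rintro ⟨j, h1, h2, rfl⟩
    obtain ⟨m, rfl⟩ : ∃ m, j = m + 1 := ⟨j - 1, by omega⟩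
    exact ⟨⟨m, by omega⟩, ⟨m + 1, by omega⟩, rfl,
      (swapConf_eq x (⟨m, by omega⟩ : Fin N) ⟨m + 1, by omega⟩ rfl).symm⟩

theorem allowed_iff [NeZero N] {x y : Config N} :
    Allowed x y ↔ (∃ j, Iface j x ∧ y = sw j x) ∨ y = fl x ∨ y = fr x := by
  have hN : 1 ≤ N := Nat.one_le_iff_ne_zero.2 (NeZero.ne N)
  rw [Allowed, isSwap_iff, flipConf_zero, flipConf_last]
  constructor
  · rintro ⟨hne, ⟨j, h1, h2, rfl⟩ | h | h⟩
    · refine Or.inl ⟨j, ⟨h1, h2, ?_⟩, rfl⟩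
      by_contra hc
      exact hne (sw_eq_self (by tauto))
    · exact Or.inr (Or.inl h)
    · exact Or.inr (Or.inr h)
  · rintro (⟨j, hj, rfl⟩ | rfl | rfl)
    · exact ⟨sw_ne_self hj, Or.inl ⟨j, hj.1, hj.2.1, rfl⟩⟩
    · exact ⟨fl_ne_self hN x, Or.inr (Or.inl rfl)⟩
    · exact ⟨fr_ne_self hN x, Or.inr (Or.inr rfl)⟩

/-- Local sums change only where the configuration does. -/
theorem sum_window (f g : ℕ → ℤ) {M : ℕ} {T : Finset ℕ} (hT : T ⊆ Finset.range M)
    (h : ∀ n ∈ Finset.range M, n ∉ T → f n = g n) :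
    ∑ n ∈ Finset.range M, f n = ∑ n ∈ Finset.range M, g n + ∑ n ∈ T, (f n - g n) := by
  rw [Finset.sum_subset hT (f := fun n => f n - g n) fun n h1 h2 => by rw [h n h1 h2, sub_self],
    Finset.sum_sub_distrib]
  ring

/-- Indicator of a proposition. -/
noncomputable def ind (p : Prop) : ℤ := if p then 1 else 0

theorem ind_true {p : Prop} (h : p) : ind p = 1 := if_pos h
theorem ind_false {p : Prop} (h : ¬ p) : ind p = 0 := if_neg h
theorem ind_cases (p : Prop) : p ∧ ind p = 1 ∨ ¬ p ∧ ind p = 0 := by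
  by_cases h : p <;> simp [ind, h]

/-- The number of occupied nearest-neighbour pairs. -/
noncomputable def bonds (x : Config N) : ℤ :=
  ∑ n ∈ Finset.range (N + 1), ind (Occ x n ∧ Occ x (n + 1))

/-- The number of maximal occupied blocks. -/
noncomputable def blocks (x : Config N) : ℤ :=
  ∑ n ∈ Finset.range (N + 1), ind (¬ Occ x n ∧ Occ x (n + 1))

/-- The sum of the positions of the particles. -/
noncomputable def moment (x : Config N) : ℤ :=
  ∑ n ∈ Finset.range (N + 1), n * ind (Occ x n)

theorem not_occ_zero (x : Config N) : ¬ Occ x 0 := fun h => by have := h.bounds; omega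

theorem not_occ_of_lt (x : Config N) {n : ℕ} (h : N < n) : ¬ Occ x n := fun h => by
  have := h.bounds; omega

theorem occ_eq_ind (x : Config N) (i : Fin N) : occ x i = ((ind (Occ x (i + 1)) : ℤ) : ℝ) := by
  rw [occ, ind, occ_succ_iff]
  split_ifs <;> simp

theorem energy_eq (κ : ℝ) (x : Config N) : energy κ x = -κ * (bonds x : ℤ) := by
  rw [energy, bonds]
  congr 1
  have h1 : ∀ i : Fin N, (∑ j : Fin N, if (j : ℕ) = (i : ℕ) + 1 then occ x i * occ x j else 0) =
      ((ind (Occ x (i + 1) ∧ Occ x (i + 1 + 1)) : ℤ) : ℝ) := by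
    intro i
    by_cases hi : (i : ℕ) + 1 < N
    · rw [Finset.sum_eq_single (⟨i + 1, hi⟩ : Fin N)]
      · rw [if_pos rfl, occ_eq_ind, occ_eq_ind]
        simp only [ind]
        by_cases a : Occ x (i + 1) <;> by_cases b : Occ x (i + 1 + 1) <;> simp [a, b]
      · intro b _ hb
        rw [if_neg]
        exact fun h => hb (Fin.ext h)
      · simp
    · rw [ind_false fun h => by have := h.2.bounds; omega]
      push_cast
      refine Finset.sum_eq_zero fun j _ => if_neg ?_
      omega
  simp only [h1]
  rw [Finset.sum_range_succ', ind_false fun h => not_occ_zero x h.1, add_zero,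
    Finset.sum_range (fun n => ind (Occ x (n + 1) ∧ Occ x (n + 1 + 1)))]
  push_cast
  rfl

section changes

variable (x : Config N)

theorem bonds_sw {j : ℕ} (h : Iface j x) : bonds (sw j x) = bonds x +
    if Occ x j then ind (Occ x (j + 2)) - ind (Occ x (j - 1))
    else ind (Occ x (j - 1)) - ind (Occ x (j + 2)) := by
  obtain ⟨h1, h2, h3⟩ := h
  rw [bonds, sum_window _ (fun n => ind (Occ x n ∧ Occ x (n + 1))) (T := {j - 1, j, j + 1})]
  · rw [bonds, Finset.sum_insert (by grind), Finset.sum_insert (by grind), Finset.sum_singleton]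
    have := Occ.bounds (x := x) (n := j - 1)
    have := Occ.bounds (x := x) (n := j + 2)
    have e1 : j - 1 + 1 = j := by omega
    simp only [occ_sw, ind, e1]
    grind
  · intro n; simp; omega
  · intro n hn hn'
    simp only [occ_sw]
    have := Occ.bounds (x := x) (n := n)
    have := Occ.bounds (x := x) (n := n + 1)
    congr 1
    grind

theorem blocks_sw {j : ℕ} (h : Iface j x) : blocks (sw j x) = blocks x -
    if Occ x j then ind (Occ x (j + 2)) - ind (Occ x (j - 1))
    else ind (Occ x (j - 1)) - ind (Occ x (j + 2)) := by
  obtain ⟨h1, h2, h3⟩ := h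
  rw [blocks, sum_window _ (fun n => ind (¬ Occ x n ∧ Occ x (n + 1))) (T := {j - 1, j, j + 1})]
  · rw [blocks, Finset.sum_insert (by grind), Finset.sum_insert (by grind), Finset.sum_singleton]
    have := Occ.bounds (x := x) (n := j - 1)
    have := Occ.bounds (x := x) (n := j + 2)
    have e1 : j - 1 + 1 = j := by omega
    simp only [occ_sw, ind, e1]
    grind
  · intro n; simp; omega
  · intro n hn hn'
    simp only [occ_sw]
    have := Occ.bounds (x := x) (n := n)
    have := Occ.bounds (x := x) (n := n + 1)
    congr 1
    grind

theorem moment_sw {j : ℕ} (h : Iface j x) :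
    moment (sw j x) = moment x + if Occ x j then 1 else -1 := by
  obtain ⟨h1, h2, h3⟩ := h
  rw [moment, sum_window _ (fun n => n * ind (Occ x n)) (T := {j, j + 1})]
  · rw [moment, Finset.sum_insert (by grind), Finset.sum_singleton]
    simp only [occ_sw, ind]
    grind
  · intro n; simp; omega
  · intro n hn hn'
    simp only [occ_sw]
    have := Occ.bounds (x := x) (n := n)
    congr 2
    grind

theorem bonds_fl (hN : 2 ≤ N) : bonds (fl x) = bonds x +
    if Occ x 1 then - ind (Occ x 2) else ind (Occ x 2) := by
  rw [bonds, sum_window _ (fun n => ind (Occ x n ∧ Occ x (n + 1))) (T := {0, 1})]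
  · rw [bonds, Finset.sum_insert (by grind), Finset.sum_singleton]
    have := not_occ_zero x
    simp only [occ_fl, ind]
    grind
  · intro n; simp; omega
  · intro n hn hn'
    simp only [occ_fl]
    have := Occ.bounds (x := x) (n := n)
    have := Occ.bounds (x := x) (n := n + 1)
    congr 1
    grind

theorem blocks_fl (hN : 2 ≤ N) (h1 : ¬ Occ x 1) :
    blocks (fl x) = blocks x + 1 - ind (Occ x 2) := by
  rw [blocks, sum_window _ (fun n => ind (¬ Occ x n ∧ Occ x (n + 1))) (T := {0, 1})]
  · rw [blocks, Finset.sum_insert (by grind), Finset.sum_singleton]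
    have := not_occ_zero x
    simp only [occ_fl, ind]
    grind
  · intro n; simp; omega
  · intro n hn hn'
    simp only [occ_fl]
    have := Occ.bounds (x := x) (n := n)
    have := Occ.bounds (x := x) (n := n + 1)
    congr 1
    grind

theorem moment_fl (hN : 2 ≤ N) (h1 : ¬ Occ x 1) : moment (fl x) = moment x + 1 := by
  rw [moment, sum_window _ (fun n => n * ind (Occ x n)) (T := {1})]
  · rw [moment, Finset.sum_singleton]
    simp only [occ_fl, ind]
    grind
  · intro n; simp; omega
  · intro n hn hn'
    simp only [occ_fl]
    have := Occ.bounds (x := x) (n := n)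
    congr 2
    grind

theorem bonds_fr (hN : 2 ≤ N) : bonds (fr x) = bonds x +
    if Occ x N then - ind (Occ x (N - 1)) else ind (Occ x (N - 1)) := by
  rw [bonds, sum_window _ (fun n => ind (Occ x n ∧ Occ x (n + 1))) (T := {N - 1, N})]
  · rw [bonds, Finset.sum_insert (by grind), Finset.sum_singleton]
    have := not_occ_of_lt x (n := N + 1) (by omega)
    have e1 : N - 1 + 1 = N := by omega
    have := Occ.bounds (x := x) (n := N - 1)
    simp only [occ_fr, ind, e1]
    grind
  · intro n; simp; omega
  · intro n hn hn'
    simp only [occ_fr]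
    have := Occ.bounds (x := x) (n := n)
    have := Occ.bounds (x := x) (n := n + 1)
    congr 1
    grind

theorem blocks_fr (hN : 2 ≤ N) (h1 : Occ x N) :
    blocks (fr x) = blocks x - 1 + ind (Occ x (N - 1)) := by
  rw [blocks, sum_window _ (fun n => ind (¬ Occ x n ∧ Occ x (n + 1))) (T := {N - 1, N})]
  · rw [blocks, Finset.sum_insert (by grind), Finset.sum_singleton]
    have := not_occ_of_lt x (n := N + 1) (by omega)
    have e1 : N - 1 + 1 = N := by omega
    have := Occ.bounds (x := x) (n := N - 1)
    simp only [occ_fr, ind, e1]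
    grind
  · intro n; simp; omega
  · intro n hn hn'
    simp only [occ_fr]
    have := Occ.bounds (x := x) (n := n)
    have := Occ.bounds (x := x) (n := n + 1)
    congr 1
    grind

theorem moment_fr (h1 : Occ x N) : moment (fr x) = moment x - N := by
  rw [moment, sum_window _ (fun n => n * ind (Occ x n)) (T := {N})]
  · rw [moment, Finset.sum_singleton]
    simp only [occ_fr, ind]
    grind
  · intro n; simp; omega
  · intro n hn hn'
    simp only [occ_fr]
    have := Occ.bounds (x := x) (n := n)
    congr 2
    grind

end changes
end Kawasaki

namespace Kawasaki

variable {N : ℕ}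

theorem sw_ne_fl {j : ℕ} (h1j : 1 ≤ j) (hjN : j + 1 ≤ N) (x : Config N) : fl x ≠ sw j x := by
  intro he
  by_cases h : Occ x j ↔ Occ x (j + 1)
  · rw [sw_eq_self h] at he
    exact fl_ne_self (by omega) x he
  · have h1 := occ_sw j x (j + 1)
    have h2 := occ_fl x (j + 1)
    have h3 := occ_sw j x 1
    have h4 := occ_fl x 1
    rw [he] at h2 h4
    have := Occ.bounds (x := x) (n := j)
    have := Occ.bounds (x := x) (n := j + 1)
    grind

theorem sw_ne_fr {j : ℕ} (h1j : 1 ≤ j) (hjN : j + 1 ≤ N) (x : Config N) : fr x ≠ sw j x := by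
  intro he
  by_cases h : Occ x j ↔ Occ x (j + 1)
  · rw [sw_eq_self h] at he
    exact fr_ne_self (by omega) x he
  · have h1 := occ_sw j x j
    have h2 := occ_fr x j
    have h3 := occ_sw j x N
    have h4 := occ_fr x N
    rw [he] at h2 h4
    have := Occ.bounds (x := x) (n := j)
    have := Occ.bounds (x := x) (n := j + 1)
    grind

theorem fl_ne_fr (hN : 2 ≤ N) (x : Config N) : fr x ≠ fl x := by
  intro he
  have h2 := occ_fr x 1
  have h4 := occ_fl x 1
  rw [he] at h2
  grind

section phi

variable [NeZero N] (κ μL μR : ℝ) (x : Config N)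

theorem phi_sw {j : ℕ} (h : Iface j x) : phi κ μL μR x (sw j x) =
    κ / 2 * ((if Occ x j then ind (Occ x (j + 2)) - ind (Occ x (j - 1))
      else ind (Occ x (j - 1)) - ind (Occ x (j + 2)) : ℤ) : ℝ) := by
  rw [phi, if_pos (isSwap_iff.2 ⟨j, h.1, h.2.1, rfl⟩), energy_eq, energy_eq, bonds_sw x h]
  push_cast
  ring

theorem phi_fl (hN : 2 ≤ N) : phi κ μL μR x (fl x) =
    if Occ x 1 then -(μL / 2 + κ / 2 * (ind (Occ x 2) : ℤ)) else
      μL / 2 + κ / 2 * (ind (Occ x 2) : ℤ) := by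
  rw [phi, if_neg, flipConf_zero, if_pos rfl, energy_eq, energy_eq, bonds_fl x hN, occ_eq_ind]
  · simp only [Fin.val_zero, zero_add]
    rcases ind_cases (Occ x 1) with ⟨h, e⟩ | ⟨h, e⟩ <;> rw [e] <;>
      simp only [h, if_true, if_false] <;>
      push_cast <;> ring
  · rw [isSwap_iff]
    rintro ⟨j, h1, h2, h⟩
    exact sw_ne_fl h1 h2 x h

theorem phi_fr (hN : 2 ≤ N) : phi κ μL μR x (fr x) =
    if Occ x N then -(μR / 2 + κ / 2 * (ind (Occ x (N - 1)) : ℤ)) else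
      μR / 2 + κ / 2 * (ind (Occ x (N - 1)) : ℤ) := by
  rw [phi, if_neg, flipConf_zero, if_neg (fl_ne_fr hN x), flipConf_last, if_pos rfl, energy_eq,
    energy_eq, bonds_fr x hN, occ_eq_ind]
  · have : ((lastIdx N : Fin N) : ℕ) + 1 = N := by simp only [lastIdx]; omega
    rw [this]
    rcases ind_cases (Occ x N) with ⟨h, e⟩ | ⟨h, e⟩ <;> rw [e] <;>
      simp only [h, if_true, if_false] <;>
      push_cast <;> ring
  · rw [isSwap_iff]
    rintro ⟨j, h1, h2, h⟩
    exact sw_ne_fr h1 h2 x h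

theorem rate_eq (β : ℝ) (y : Config N) : rate κ μL μR β x y =
    if Allowed x y then Real.exp (phi κ μL μR x y * β) else 0 := by
  by_cases hxy : y = x
  · rw [rate, if_pos hxy, if_neg fun h => h.1 hxy]
  rw [rate, if_neg hxy, phi, Allowed]
  by_cases h1 : IsSwap x y
  · simp only [h1, if_true, hxy, true_or, ne_eq, not_false_eq_true, and_self]
    ring_nf
  by_cases h2 : y = flipConf x 0
  · rw [if_neg h1, if_pos h2, if_pos ⟨hxy, Or.inr (Or.inl h2)⟩, if_neg h1, if_pos h2,
      ← Real.exp_add]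
    ring_nf
  by_cases h3 : y = flipConf x (lastIdx N)
  · rw [if_neg h1, if_neg h2, if_pos h3, if_pos ⟨hxy, Or.inr (Or.inr h3)⟩, if_neg h1, if_neg h2,
      if_pos h3, ← Real.exp_add]
    ring_nf
  · simp [h1, h2, h3]

end phi

theorem sw_sw {j : ℕ} {x : Config N} (h : Iface j x) : sw j (sw j x) = x := by
  refine ext_occ fun n h1 h2 => ?_
  obtain ⟨a, b, c⟩ := h
  simp only [occ_sw]
  grind

theorem fl_fl (x : Config N) : fl (fl x) = x := by
  refine ext_occ fun n h1 h2 => ?_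
  simp only [occ_fl]
  grind

theorem fr_fr (x : Config N) : fr (fr x) = x := by
  refine ext_occ fun n h1 h2 => ?_
  simp only [occ_fr]
  grind

theorem Iface.sw {j : ℕ} {x : Config N} (h : Iface j x) : Iface j (sw j x) := by
  obtain ⟨a, b, c⟩ := h
  refine ⟨a, b, ?_⟩
  simp only [occ_sw]
  grind

variable [NeZero N]

theorem Allowed.symm {x y : Config N} (h : Allowed x y) : Allowed y x := by
  rw [allowed_iff] at h ⊢
  rcases h with ⟨j, hj, rfl⟩ | rfl | rfl
  · exact Or.inl ⟨j, hj.sw, (sw_sw hj).symm⟩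
  · exact Or.inr (Or.inl (fl_fl x).symm)
  · exact Or.inr (Or.inr (fr_fr x).symm)

omit [NeZero N] in
theorem moment_nonneg (x : Config N) : 0 ≤ moment x :=
  Finset.sum_nonneg fun n _ => by
    rcases ind_cases (Occ x n) with ⟨-, h⟩ | ⟨-, h⟩ <;> simp [h]

omit [NeZero N] in
theorem exists_iface_of_not {x : Config N} {a b : ℕ} (ha : 1 ≤ a) (hab : a ≤ b) (hb : b ≤ N)
    (h : ¬ (Occ x a ↔ Occ x b)) : ∃ j, a ≤ j ∧ j < b ∧ Iface j x := by
  induction b, hab using Nat.le_induction with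
  | base => exact absurd Iff.rfl h
  | succ b hb' ih =>
    by_cases h2 : Occ x a ↔ Occ x b
    · exact ⟨b, hb', by omega, by omega, hb, by tauto⟩
    · obtain ⟨j, h3, h4, h5⟩ := ih (by omega) h2
      exact ⟨j, h3, by omega, h5⟩

theorem exists_allowed_moment_lt (hN : 2 ≤ N) {x : Config N} (hx : x ≠ ofPred N fun _ => False) :
    ∃ y, Allowed x y ∧ moment y < moment x := by
  by_cases h1 : Occ x 1
  · refine ⟨fl x, allowed_iff.2 (Or.inr (Or.inl rfl)), ?_⟩
    have h := moment_fl (fl x) hN (by rw [occ_fl]; grind)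
    rw [fl_fl] at h
    omega
  · obtain ⟨n, hn, hn1⟩ : ∃ n, Occ x n ∧ ∀ m < n, ¬ Occ x m := by
      have : ∃ n, Occ x n := by
        by_contra! hc
        exact hx (ext_occ fun n _ _ => by simp [occ_ofPred, hc n])
      exact ⟨Nat.find this, Nat.find_spec this, fun m hm => Nat.find_min this hm⟩
    have hb := hn.bounds
    have hn2 : n ≠ 1 := by rintro rfl; exact h1 hn
    have e : n - 1 + 1 = n := by omega
    have hi : Iface (n - 1) x := ⟨by omega, by omega, by
      rw [e]; have := hn1 (n - 1) (by omega); tauto⟩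
    refine ⟨sw (n - 1) x, allowed_iff.2 (Or.inl ⟨n - 1, hi, rfl⟩), ?_⟩
    rw [moment_sw x hi, if_neg (hn1 _ (by omega))]
    omega

theorem mem_empty_of_closed (hN : 2 ≤ N) {A : Set (Config N)} (hne : A.Nonempty)
    (hA : ∀ y ∈ A, ∀ x, Allowed y x → x ∈ A) : (ofPred N fun _ => False) ∈ A := by
  obtain ⟨x, hx⟩ := hne
  induction h : (moment x).toNat using Nat.strong_induction_on generalizing x with
  | _ n ih =>
    by_cases hx0 : x = ofPred N fun _ => False
    · rwa [← hx0]
    · obtain ⟨y, hy, hlt⟩ := exists_allowed_moment_lt hN hx0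
      have := moment_nonneg y
      exact ih _ (by omega) y (hA x hx y hy) rfl

theorem eq_univ_of_closed (hN : 2 ≤ N) {A : Set (Config N)} (hne : A.Nonempty)
    (hA : ∀ y ∈ A, ∀ x, Allowed y x → x ∈ A) : A = Set.univ := by
  by_contra h
  have h2 : (Aᶜ : Set (Config N)).Nonempty := Set.nonempty_compl.2 h
  exact mem_empty_of_closed hN h2 (fun y hy x hyx hx => hy (hA x hx y hyx.symm))
    (mem_empty_of_closed hN hne hA)

/-- The logarithmic rates `v` of the stationary distribution satisfy tropical cut balance. -/
structure IsRate (κ μL μR : ℝ) (v : Config N → ℝ) : Prop where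
  nonpos : ∀ x, v x ≤ 0
  exists_eq_zero : ∃ x, v x = 0
  cut : ∀ (A : Set (Config N)) (x y : Config N), x ∈ A → y ∉ A → Allowed x y →
    ∃ x' y', x' ∉ A ∧ y' ∈ A ∧ Allowed x' y' ∧
      v x + phi κ μL μR x y ≤ v x' + phi κ μL μR x' y'

open Filter Topology MarkovChain in
theorem exists_isRate (hN : 2 ≤ N) (κ μL μR : ℝ) (ρ : ℝ → Config N → ℝ)
    (hρ : ∀ β : ℝ, 0 < β → IsStationary κ μL μR β (ρ β)) :
    ∃ v, IsRate κ μL μR v ∧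
      ∀ x, Tendsto (fun β : ℝ => Real.log (ρ β x) / β) atTop (𝓝 (v x)) := by
  set K : Config N → Config N → AddMonoidAlgebra ℝ ℝ := fun x y =>
    if Allowed x y then AddMonoidAlgebra.single (phi κ μL μR x y) 1 else 0 with hK
  have hKe : ∀ β x y, expEval β (K x y) = rate κ μL μR β x y := fun β x y => by
    rw [rate_eq κ μL μR x, hK]
    simp only
    split_ifs
    · rw [expEval_single]
    · rw [map_zero]
  have hk : ∀ β, ∀ x y, 0 ≤ expEval β (K x y) := fun β x y => by
    rw [hKe, rate_eq κ μL μR x]; split_ifs <;> positivity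
  have hirr : ∀ β, Irred fun x y => expEval β (K x y) := fun β A hne hA => by
    refine eq_univ_of_closed hN hne fun y hy x hyx => hA y hy x ?_
    simp only [hKe, rate_eq κ μL μR x, if_pos hyx.symm]
    positivity
  have hb : ∀ β, 0 < β → Balanced (fun x y => expEval β (K x y)) (ρ β) := fun β hβ x => by
    simp only [hKe]; exact (hρ β hβ).2.2 x
  have h0 : ∀ β, 0 < β → ∀ x, 0 ≤ ρ β x := fun β hβ => (hρ β hβ).1
  have h1 : ∀ β, 0 < β → ∑ x, ρ β x = 1 := fun β hβ => (hρ β hβ).2.1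
  have hpos : ∀ β, 0 < β → ∀ x, 0 < ρ β x := fun β hβ x =>
    (hb β hβ).pos (hk β) (hirr β) (h0 β hβ) (h1 β hβ) x
  choose v hv using exists_tendsto_log K ρ hk hirr hb h0 h1
  obtain ⟨hn, he⟩ := exists_rate_eq_zero hpos h1 hv
  refine ⟨v, ⟨hn, he, fun A x y hx hy hxy => ?_⟩, hv⟩
  refine exists_edge_ge (k := fun β x y => expEval β (K x y)) (E := Allowed) ?_ hb hpos hv hx hy hxy
  intro β x y
  rw [hKe, rate_eq κ μL μR x]

end Kawasaki

namespace Kawasaki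

variable {N : ℕ}

/-- Exchanges that merge two blocks. -/
def Gain (j : ℕ) (x : Config N) : Prop :=
  Iface j x ∧ (Occ x (j + 2) ↔ Occ x j) ∧ (Occ x (j - 1) ↔ Occ x (j + 1))

/-- Exchanges that do not change the energy. -/
def Neut (j : ℕ) (x : Config N) : Prop := Iface j x ∧ (Occ x (j - 1) ↔ Occ x (j + 2))

/-- Exchanges that split a block. -/
def Loss (j : ℕ) (x : Config N) : Prop :=
  Iface j x ∧ (Occ x (j + 2) ↔ Occ x (j + 1)) ∧ (Occ x (j - 1) ↔ Occ x j)

theorem Iface.cases {j : ℕ} {x : Config N} (h : Iface j x) : Gain j x ∨ Neut j x ∨ Loss j x := by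
  have := h.2.2
  unfold Gain Neut Loss
  tauto

theorem Gain.blocks {j : ℕ} {x : Config N} (h : Gain j x) : blocks (sw j x) = blocks x - 1 := by
  rw [blocks_sw x h.1]
  obtain ⟨⟨_, _, h1⟩, h2, h3⟩ := h
  simp only [ind]
  grind

theorem Neut.blocks {j : ℕ} {x : Config N} (h : Neut j x) : blocks (sw j x) = blocks x := by
  rw [blocks_sw x h.1]
  obtain ⟨⟨_, _, h1⟩, h2⟩ := h
  simp only [ind]
  grind

theorem Loss.blocks {j : ℕ} {x : Config N} (h : Loss j x) : blocks (sw j x) = blocks x + 1 := by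
  rw [blocks_sw x h.1]
  obtain ⟨⟨_, _, h1⟩, h2, h3⟩ := h
  simp only [ind]
  grind

section phi

variable [NeZero N] {κ μL μR : ℝ} {x : Config N} {j : ℕ}

theorem Gain.phi (h : Gain j x) : phi κ μL μR x (sw j x) = κ / 2 := by
  rw [phi_sw κ μL μR x h.1]
  obtain ⟨⟨_, _, h1⟩, h2, h3⟩ := h
  by_cases h4 : Occ x j
  · rw [if_pos h4, ind_true (by tauto), ind_false (by tauto)]; norm_num
  · rw [if_neg h4, ind_true (by tauto), ind_false (by tauto)]; norm_num

theorem Neut.phi (h : Neut j x) : phi κ μL μR x (sw j x) = 0 := by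
  rw [phi_sw κ μL μR x h.1]
  obtain ⟨⟨_, _, h1⟩, h2⟩ := h
  simp only [ind, h2]
  simp

theorem Loss.phi (h : Loss j x) : phi κ μL μR x (sw j x) = -(κ / 2) := by
  rw [phi_sw κ μL μR x h.1]
  obtain ⟨⟨_, _, h1⟩, h2, h3⟩ := h
  by_cases h4 : Occ x j
  · rw [if_pos h4, ind_false (by tauto), ind_true (by tauto)]; norm_num
  · rw [if_neg h4, ind_false (by tauto), ind_true (by tauto)]; norm_num

end phi

/-- The parameter regime. -/
structure Regime (N : ℕ) (κ μL μR : ℝ) : Prop where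
  five_le : 5 ≤ N
  pos : 0 < κ
  left : κ < μL
  right : κ < -μR

variable [NeZero N] {κ μL μR : ℝ}

theorem Allowed.cases {x y : Config N} (h : Allowed x y) :
    (∃ j, Gain j x ∧ y = sw j x) ∨ (∃ j, Neut j x ∧ y = sw j x) ∨ (∃ j, Loss j x ∧ y = sw j x) ∨
      y = fl x ∨ y = fr x := by
  rcases allowed_iff.1 h with ⟨j, hj, rfl⟩ | h | h
  · rcases hj.cases with h | h | h
    · exact Or.inl ⟨j, h, rfl⟩
    · exact Or.inr (Or.inl ⟨j, h, rfl⟩)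
    · exact Or.inr (Or.inr (Or.inl ⟨j, h, rfl⟩))
  · tauto
  · tauto

theorem allowed_sw {x : Config N} {j : ℕ} (h : Iface j x) : Allowed x (sw j x) :=
  allowed_iff.2 (Or.inl ⟨j, h, rfl⟩)

theorem allowed_fl (x : Config N) : Allowed x (fl x) := allowed_iff.2 (Or.inr (Or.inl rfl))

theorem allowed_fr (x : Config N) : Allowed x (fr x) := allowed_iff.2 (Or.inr (Or.inr rfl))

section values

variable (r : Regime N κ μL μR) {x : Config N}
include r

theorem phi_fl_insert_one (h1 : ¬ Occ x 1) (h2 : Occ x 2) :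
    phi κ μL μR x (fl x) = μL / 2 + κ / 2 := by
  have := r.five_le
  rw [phi_fl _ _ _ _ (by omega), if_neg h1, ind_true h2]; norm_num

theorem phi_fl_insert_zero (h1 : ¬ Occ x 1) (h2 : ¬ Occ x 2) :
    phi κ μL μR x (fl x) = μL / 2 := by
  have := r.five_le
  rw [phi_fl _ _ _ _ (by omega), if_neg h1, ind_false h2]; norm_num

theorem phi_fl_remove_one (h1 : Occ x 1) (h2 : Occ x 2) :
    phi κ μL μR x (fl x) = -(μL / 2 + κ / 2) := by
  have := r.five_le
  rw [phi_fl _ _ _ _ (by omega), if_pos h1, ind_true h2]; norm_num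

theorem phi_fl_remove_zero (h1 : Occ x 1) (h2 : ¬ Occ x 2) :
    phi κ μL μR x (fl x) = -(μL / 2) := by
  have := r.five_le
  rw [phi_fl _ _ _ _ (by omega), if_pos h1, ind_false h2]; norm_num

theorem phi_fr_insert_one (h1 : ¬ Occ x N) (h2 : Occ x (N - 1)) :
    phi κ μL μR x (fr x) = μR / 2 + κ / 2 := by
  have := r.five_le
  rw [phi_fr _ _ _ _ (by omega), if_neg h1, ind_true h2]; norm_num

theorem phi_fr_insert_zero (h1 : ¬ Occ x N) (h2 : ¬ Occ x (N - 1)) :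
    phi κ μL μR x (fr x) = μR / 2 := by
  have := r.five_le
  rw [phi_fr _ _ _ _ (by omega), if_neg h1, ind_false h2]; norm_num

theorem phi_fr_remove_one (h1 : Occ x N) (h2 : Occ x (N - 1)) :
    phi κ μL μR x (fr x) = -(μR / 2 + κ / 2) := by
  have := r.five_le
  rw [phi_fr _ _ _ _ (by omega), if_pos h1, ind_true h2]; norm_num

theorem phi_fr_remove_zero (h1 : Occ x N) (h2 : ¬ Occ x (N - 1)) :
    phi κ μL μR x (fr x) = -(μR / 2) := by
  have := r.five_le
  rw [phi_fr _ _ _ _ (by omega), if_pos h1, ind_false h2]; norm_num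

theorem phi_fl_lt (h1 : Occ x 1) : phi κ μL μR x (fl x) < -(κ / 2) := by
  have := r.left
  have := r.pos
  by_cases h2 : Occ x 2
  · rw [phi_fl_remove_one r h1 h2]; linarith
  · rw [phi_fl_remove_zero r h1 h2]; linarith

theorem phi_fl_lt_of_two (h1 : Occ x 1) (h2 : Occ x 2) : phi κ μL μR x (fl x) < -κ := by
  have := r.left
  rw [phi_fl_remove_one r h1 h2]; linarith

theorem lt_phi_fl (h1 : ¬ Occ x 1) : κ / 2 < phi κ μL μR x (fl x) := by
  have := r.left
  have := r.pos
  by_cases h2 : Occ x 2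
  · rw [phi_fl_insert_one r h1 h2]; linarith
  · rw [phi_fl_insert_zero r h1 h2]; linarith

theorem phi_fr_lt (h1 : ¬ Occ x N) : phi κ μL μR x (fr x) < 0 := by
  have := r.right
  have := r.pos
  by_cases h2 : Occ x (N - 1)
  · rw [phi_fr_insert_one r h1 h2]; linarith
  · rw [phi_fr_insert_zero r h1 h2]; linarith

theorem phi_fr_lt_of_pred (h1 : ¬ Occ x N) (h2 : ¬ Occ x (N - 1)) :
    phi κ μL μR x (fr x) < -(κ / 2) := by
  have := r.right
  rw [phi_fr_insert_zero r h1 h2]; linarith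

/-- The removal of a particle at the last site has a positive exponent. -/
theorem phi_fr_gt (h1 : Occ x N) : 0 < phi κ μL μR x (fr x) := by
  have := r.right
  have := r.pos
  by_cases h2 : Occ x (N - 1)
  · rw [phi_fr_remove_one r h1 h2]; linarith
  · rw [phi_fr_remove_zero r h1 h2]; linarith

end values

/-- `y` maximizes the rate exponent among the transitions from `x`. -/
def Fastest (κ μL μR : ℝ) (x y : Config N) : Prop :=
  Allowed x y ∧ ∀ u, Allowed x u → phi κ μL μR x u ≤ phi κ μL μR x y

section max

variable (r : Regime N κ μL μR) {x : Config N}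
include r

theorem fastest_fill (h1 : ¬ Occ x 1) (hN : ¬ Occ x N) : Fastest κ μL μR x (fl x) := by
  have h := lt_phi_fl r h1
  have := r.pos
  refine ⟨allowed_fl x, fun u hu => ?_⟩
  rcases hu.cases with ⟨j, hj, rfl⟩ | ⟨j, hj, rfl⟩ | ⟨j, hj, rfl⟩ | rfl | rfl
  · rw [hj.phi]; linarith
  · rw [hj.phi]; linarith
  · rw [hj.phi]; linarith
  · rfl
  · linarith [phi_fr_lt r hN]

theorem fastest_fill_or (h1 : ¬ Occ x 1) :
    Fastest κ μL μR x (fl x) ∨ Occ x N ∧ Fastest κ μL μR x (fr x) := by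
  by_cases hN : Occ x N
  · have h := lt_phi_fl r h1
    have := r.pos
    rcases le_total (phi κ μL μR x (fl x)) (phi κ μL μR x (fr x)) with hle | hle
    · refine Or.inr ⟨hN, allowed_fr x, fun u hu => ?_⟩
      rcases hu.cases with ⟨j, hj, rfl⟩ | ⟨j, hj, rfl⟩ | ⟨j, hj, rfl⟩ | rfl | rfl
      · rw [hj.phi]; linarith
      · rw [hj.phi]; linarith
      · rw [hj.phi]; linarith
      · exact hle
      · rfl
    · refine Or.inl ⟨allowed_fl x, fun u hu => ?_⟩
      rcases hu.cases with ⟨j, hj, rfl⟩ | ⟨j, hj, rfl⟩ | ⟨j, hj, rfl⟩ | rfl | rfl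
      · rw [hj.phi]; linarith
      · rw [hj.phi]; linarith
      · rw [hj.phi]; linarith
      · rfl
      · exact hle
  · exact Or.inl (fastest_fill r h1 hN)

theorem phi_le_of_not_gain (h1 : Occ x 1) (hN : ¬ Occ x N) (hg : ∀ j, ¬ Gain j x) :
    ∀ u, Allowed x u → phi κ μL μR x u ≤ 0 := by
  intro u hu
  have := r.pos
  rcases hu.cases with ⟨j, hj, rfl⟩ | ⟨j, hj, rfl⟩ | ⟨j, hj, rfl⟩ | rfl | rfl
  · exact absurd hj (hg j)
  · rw [hj.phi]
  · rw [hj.phi]; linarith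
  · linarith [phi_fl_lt r h1]
  · linarith [phi_fr_lt r hN]

theorem phi_le_half (h1 : Occ x 1) (hN : ¬ Occ x N) :
    ∀ u, Allowed x u → phi κ μL μR x u ≤ κ / 2 := by
  intro u hu
  have := r.pos
  rcases hu.cases with ⟨j, hj, rfl⟩ | ⟨j, hj, rfl⟩ | ⟨j, hj, rfl⟩ | rfl | rfl
  · rw [hj.phi]
  · rw [hj.phi]; linarith
  · rw [hj.phi]; linarith
  · linarith [phi_fl_lt r h1]
  · linarith [phi_fr_lt r hN]

theorem phi_le_of_loss (h1 : Occ x 1) (hN : ¬ Occ x N) (hN1 : ¬ Occ x (N - 1))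
    (hl : ∀ j, Iface j x → Loss j x) : ∀ u, Allowed x u → phi κ μL μR x u ≤ -(κ / 2) := by
  intro u hu
  have := r.pos
  rcases allowed_iff.1 hu with ⟨j, hj, rfl⟩ | rfl | rfl
  · rw [(hl j hj).phi]
  · linarith [phi_fl_lt r h1]
  · linarith [phi_fr_lt_of_pred r hN hN1]

theorem fastest_remove (h1 : Occ x 1) (hN : Occ x N) :
    Fastest κ μL μR x (fr x) ∨ ∃ j, Gain j x ∧ Fastest κ μL μR x (sw j x) := by
  have := r.pos
  have h := phi_fr_gt r hN
  have hl := phi_fl_lt r h1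
  have hgl : ∀ j, Gain j x → phi κ μL μR x (sw j x) = κ / 2 := fun j hj => hj.phi
  by_cases hg : (∃ j, Gain j x) ∧ phi κ μL μR x (fr x) ≤ κ / 2
  · obtain ⟨⟨j, hj⟩, hle⟩ := hg
    refine Or.inr ⟨j, hj, allowed_sw hj.1, fun u hu => ?_⟩
    rw [hj.phi]
    rcases hu.cases with ⟨j, hj, rfl⟩ | ⟨j, hj, rfl⟩ | ⟨j, hj, rfl⟩ | rfl | rfl
    · rw [hj.phi]
    · rw [hj.phi]; linarith
    · rw [hj.phi]; linarith
    · linarith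
    · exact hle
  · refine Or.inl ⟨allowed_fr x, fun u hu => ?_⟩
    rcases hu.cases with ⟨j, hj, rfl⟩ | ⟨j, hj, rfl⟩ | ⟨j, hj, rfl⟩ | rfl | rfl
    · rw [hj.phi]
      by_contra hc
      exact hg ⟨⟨j, hj⟩, by linarith⟩
    · rw [hj.phi]; linarith
    · rw [hj.phi]; linarith
    · linarith
    · rfl

theorem fastest_gain {j : ℕ} (h1 : Occ x 1) (hN : ¬ Occ x N) (hj : Gain j x) :
    Fastest κ μL μR x (sw j x) :=
  ⟨allowed_sw hj.1, fun u hu => by rw [hj.phi]; exact phi_le_half r h1 hN u hu⟩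

theorem fastest_neut {j : ℕ} (h1 : Occ x 1) (hN : ¬ Occ x N) (hg : ∀ j, ¬ Gain j x)
    (hj : Neut j x) : Fastest κ μL μR x (sw j x) :=
  ⟨allowed_sw hj.1, fun u hu => by rw [hj.phi]; exact phi_le_of_not_gain r h1 hN hg u hu⟩

theorem fastest_loss {j : ℕ} (h1 : Occ x 1) (hN : ¬ Occ x N) (hN1 : ¬ Occ x (N - 1))
    (hl : ∀ j, Iface j x → Loss j x) (hj : Iface j x) : Fastest κ μL μR x (sw j x) :=
  ⟨allowed_sw hj, fun u hu => by
    rw [(hl j hj).phi]; exact phi_le_of_loss r h1 hN hN1 hl u hu⟩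

end max

section levels

variable (κ μL μR) (v : Config N → ℝ)

/-- Transitions carrying a flux of exponential order at least `ℓ`. -/
def Edge (ℓ : ℝ) (x y : Config N) : Prop := Allowed x y ∧ ℓ ≤ v x + phi κ μL μR x y

/-- Connection through transitions of flux at least `ℓ`. -/
def Reach (ℓ : ℝ) : Config N → Config N → Prop := Relation.ReflTransGen (Edge κ μL μR v ℓ)

/-- Some transition from `x` carries a flux at least `ℓ`. -/
def Live (ℓ : ℝ) (x : Config N) : Prop := ∃ y, Edge κ μL μR v ℓ x y

end levels

variable {v : Config N → ℝ} {ℓ : ℝ}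

theorem Edge.mono {ℓ' : ℝ} {x y : Config N} (h : Edge κ μL μR v ℓ x y) (hl : ℓ' ≤ ℓ) :
    Edge κ μL μR v ℓ' x y := ⟨h.1, hl.trans h.2⟩

theorem Reach.mono {ℓ' : ℝ} {x y : Config N} (h : Reach κ μL μR v ℓ x y) (hl : ℓ' ≤ ℓ) :
    Reach κ μL μR v ℓ' x y :=
  Relation.ReflTransGen.mono (p := Edge κ μL μR v ℓ') (fun _ _ h' => Edge.mono h' hl) _ _ h

theorem Edge.reach {x y : Config N} (h : Edge κ μL μR v ℓ x y) : Reach κ μL μR v ℓ x y :=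
  Relation.ReflTransGen.single h

theorem Reach.trans {x y z : Config N} (h : Reach κ μL μR v ℓ x y)
    (h' : Reach κ μL μR v ℓ y z) : Reach κ μL μR v ℓ x z := Relation.ReflTransGen.trans h h'

theorem Live.edge {x y : Config N} (h : Live κ μL μR v ℓ x) (hm : Fastest κ μL μR x y) :
    Edge κ μL μR v ℓ x y := by
  obtain ⟨z, h1, h2⟩ := h
  exact ⟨hm.1, by linarith [hm.2 z h1]⟩

theorem Live.le {c : ℝ} {x : Config N} (h : Live κ μL μR v ℓ x)
    (hc : ∀ u, Allowed x u → phi κ μL μR x u ≤ c) : ℓ - c ≤ v x := by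
  obtain ⟨z, h1, h2⟩ := h
  linarith [hc z h1]

theorem Reach.exists_exit {x y : Config N} (h : Reach κ μL μR v ℓ x y) {A : Set (Config N)}
    (hx : x ∈ A) (hy : y ∉ A) : ∃ a ∈ A, ∃ b ∉ A, Edge κ μL μR v ℓ a b := by
  induction h with
  | refl => exact absurd hx hy
  | @tail b c _ hbc ih =>
    by_cases hb : b ∈ A
    · exact ⟨b, hb, c, hy, hbc⟩
    · exact ih hb

section rate

variable (hv : IsRate κ μL μR v)
include hv

theorem Reach.symm {x y : Config N} (h : Reach κ μL μR v ℓ x y) : Reach κ μL μR v ℓ y x := by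
  induction h with
  | refl => exact Relation.ReflTransGen.refl
  | @tail b c _ hbc ih =>
    refine Reach.trans ?_ ih
    by_contra hcon
    obtain ⟨x', y', hx', hy', hE, hle⟩ := hv.cut {z | ¬ Reach κ μL μR v ℓ c z} b c hcon
      (fun h => h Relation.ReflTransGen.refl) hbc.1
    refine hy' (Relation.ReflTransGen.tail (not_not.1 hx') ⟨hE, hbc.2.trans hle⟩)

theorem Edge.live {x y : Config N} (h : Edge κ μL μR v ℓ x y) : Live κ μL μR v ℓ y := by
  obtain ⟨x', y', hx', -, hE, hle⟩ := hv.cut {y}ᶜ x y (fun h' => h.1.1 h'.symm)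
    (fun h' => h' rfl) h.1
  obtain rfl : x' = y := not_not.1 hx'
  exact ⟨y', hE, h.2.trans hle⟩

end rate

/-- Sets of configurations closed under maximizing transitions. -/
def MaxClosed (κ μL μR : ℝ) (S : Set (Config N)) : Prop :=
  ∀ x ∈ S, ∀ y, Fastest κ μL μR x y → y ∈ S

theorem maxClosed_reach (hv : IsRate κ μL μR v) (ℓ : ℝ) (x₀ : Config N) :
    MaxClosed κ μL μR {x | Live κ μL μR v ℓ x ∧ Reach κ μL μR v ℓ x₀ x} := by
  rintro x ⟨h1, h2⟩ y hm
  exact ⟨(h1.edge hm).live hv, Relation.ReflTransGen.tail h2 (h1.edge hm)⟩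

end Kawasaki

namespace Kawasaki

variable {N : ℕ}

/-- How far the configuration is from starting with three particles. -/
noncomputable def defect (x : Config N) : ℤ := if ¬ Occ x 2 then 2 else if ¬ Occ x 3 then 1 else 0

/-- Lexicographic comparison of blocks, defect and moment. -/
def Lower (y x : Config N) : Prop :=
  blocks y < blocks x ∨ blocks y = blocks x ∧
    (defect y < defect x ∨ defect y = defect x ∧ moment y < moment x)

/-- The last three sites are empty. -/
def Tail (x : Config N) : Prop := ¬ Occ x N ∧ ¬ Occ x (N - 1) ∧ ¬ Occ x (N - 2)

theorem exists_minimal {S : Set (Config N)} (h : S.Nonempty) : ∃ y ∈ S, ∀ z ∈ S, ¬ Lower z y := by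
  have : IsTrans (Config N) Lower := ⟨fun a b c h1 h2 => by unfold Lower at *; omega⟩
  have : Std.Irrefl (Lower (N := N)) := ⟨fun a h1 => by unfold Lower at *; omega⟩
  have hwf : WellFounded (Lower (N := N)) := Finite.wellFounded_of_trans_of_irrefl _
  exact ⟨hwf.min S h, hwf.min_mem S h, fun z hz => hwf.not_lt_min S hz⟩

/-- Local minima of the energy landscape: every exchange costs energy, blocks and gaps are wide,
and the two last sites are empty. -/
structure Stable (x : Config N) : Prop where
  first : Occ x 1
  last : ¬ Occ x N
  pred : ¬ Occ x (N - 1)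
  loss : ∀ j, Iface j x → Loss j x
  block : ∀ i, Occ x (i + 1) → Occ x (i + 2) → Occ x i ∨ Occ x (i + 3)
  gap : ∀ i, Occ x i → ¬ Occ x (i + 1) → ¬ Occ x (i + 2) → ¬ Occ x (i + 3)

theorem Stable.two (hN : 2 ≤ N) {x : Config N} (h : Stable x) : Occ x 2 := by
  by_contra h2
  have := (h.loss 1 ⟨le_rfl, by omega, by simp [h.first, h2]⟩).2.2
  exact not_occ_zero x (this.2 h.first)

theorem Stable.three (hN : 2 ≤ N) {x : Config N} (h : Stable x) : Occ x 3 :=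
  (h.block 0 h.first (h.two hN)).resolve_left (not_occ_zero x)

/-- Some configuration of `S` with occupied first site is lower than `y`. -/
def Better (S : Set (Config N)) (y : Config N) : Prop :=
  ∃ y' ∈ S, Occ y' 1 ∧ Lower y' y ∧ (6 ≤ N → Tail y → Tail y')

variable [NeZero N] {κ μL μR : ℝ} (r : Regime N κ μL μR) {S : Set (Config N)}
  (hS : MaxClosed κ μL μR S)
include r hS

theorem exists_fill {z : Config N} (hz : z ∈ S) (h1 : ¬ Occ z 1) :
    ∃ z' ∈ S, Occ z' 1 ∧ (z' = fl z ∨ Occ z N ∧ z' = fl (fr z)) := by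
  have hN := r.five_le
  rcases fastest_fill_or r h1 with h | ⟨h2, h⟩
  · refine ⟨_, hS z hz _ h, ?_, Or.inl rfl⟩
    rw [occ_fl]; grind
  · have hf := hS z hz _ h
    refine ⟨fl (fr z), hS _ hf _ (fastest_fill r ?_ ?_), ?_, Or.inr ⟨h2, rfl⟩⟩
    · rw [occ_fr]; grind
    · rw [occ_fr]; grind
    · rw [occ_fl, occ_fr]; grind

theorem better_of_fill {y z : Config N} (hz : z ∈ S) (h1 : ¬ Occ z 1) (hl : Lower (fl z) y)
    (ht : 6 ≤ N → Tail y → Tail (fl z)) : Better S y := by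
  have hN := r.five_le
  obtain ⟨z', hz', ho, rfl | ⟨h2, rfl⟩⟩ := exists_fill r hS hz h1
  · exact ⟨_, hz', ho, hl, ht⟩
  · refine ⟨_, hz', ho, ?_, fun h6 hy => ?_⟩
    · have e1 := blocks_fl z (by omega) h1
      have e2 := blocks_fl (fr z) (by omega) (by rw [occ_fr]; grind)
      have e3 := blocks_fr z (by omega) h2
      have e4 := moment_fl z (by omega) h1
      have e5 := moment_fl (fr z) (by omega) (by rw [occ_fr]; grind)
      have e6 := moment_fr z h2
      have e7 : Occ (fr z) 2 ↔ Occ z 2 := by rw [occ_fr]; grind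
      have e8 : defect (fl (fr z)) = defect (fl z) := by
        simp only [defect, occ_fl, occ_fr]; grind
      rw [e7] at e2
      have := ind_cases (Occ z (N - 1))
      unfold Lower at *
      omega
    · have := ht h6 hy
      simp only [Tail, occ_fl, occ_fr] at *
      grind

theorem better_of_gain {y : Config N} {j : ℕ} (hy : y ∈ S) (h1 : Occ y 1) (hj : Gain j y)
    (hm : Fastest κ μL μR y (sw j y)) : Better S y := by
  have hN := r.five_le
  have hb := hj.blocks
  have hmem := hS y hy _ hm
  obtain ⟨⟨a, b, c⟩, d, e⟩ := hj
  have o1 := Occ.bounds (x := y) (n := j + 2)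
  have o2 := Occ.bounds (x := y) (n := j + 1)
  have h0 := not_occ_zero y
  by_cases hj1 : j = 1
  · subst hj1
    have h0 : Occ (sw 1 y) 2 := by rw [occ_sw]; grind
    have h1' : ¬ Occ (sw 1 y) 1 := by rw [occ_sw]; grind
    refine better_of_fill r hS hmem h1' (Or.inl ?_) fun h6 ht => ?_
    · rw [blocks_fl _ (by omega) h1', ind_true h0]
      omega
    · simp only [Tail, occ_fl, occ_sw] at *
      grind
  · refine ⟨_, hmem, ?_, Or.inl (by omega), fun h6 ht => ?_⟩
    · rw [occ_sw]; grind
    · simp only [Tail, occ_sw] at *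
      grind

theorem better_of_remove {y : Config N} (hy : y ∈ S) (h1 : Occ y 1)
    (hN : Occ y N) : Better S y := by
  have hN5 := r.five_le
  rcases fastest_remove r h1 hN with h | ⟨j, hj, h⟩
  · refine ⟨_, hS y hy _ h, ?_, ?_, fun _ ht => absurd hN ht.1⟩
    · rw [occ_fr]; grind
    · have e1 := blocks_fr y (by omega) hN
      have e2 := moment_fr y hN
      have e3 : defect (fr y) = defect y := by simp only [defect, occ_fr]; grind
      have := ind_cases (Occ y (N - 1))
      unfold Lower
      omega
  · exact better_of_gain r hS hy h1 hj h

theorem better_of_left {y : Config N} {j : ℕ} (hy : y ∈ S) (h1 : Occ y 1) (hN : ¬ Occ y N)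
    (hg : ∀ j, ¬ Gain j y) (hj : Neut j y) (hl : ¬ Occ y j) : Better S y := by
  have hN5 := r.five_le
  have hmem := hS y hy _ (fastest_neut r h1 hN hg hj)
  have hb := hj.blocks
  have hm := moment_sw y hj.1
  rw [if_neg hl] at hm
  obtain ⟨⟨a, b, c⟩, d⟩ := hj
  refine ⟨_, hmem, ?_, Or.inr ⟨hb, ?_⟩, fun h6 ht => ?_⟩
  · rw [occ_sw]; grind
  · have : defect (sw j y) ≤ defect y := by
      simp only [defect, occ_sw]
      grind
    omega
  · simp only [Tail, occ_sw] at *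
    have := Occ.bounds (x := y) (n := j + 1)
    grind

theorem better_of_neut {y : Config N} {j : ℕ} (hy : y ∈ S) (h1 : Occ y 1) (hN : ¬ Occ y N)
    (hg : ∀ j, ¬ Gain j y) (hj : Neut j y) : Better S y := by
  have hN5 := r.five_le
  have h0 := not_occ_zero y
  have o2 := Occ.bounds (x := y) (n := j + 2)
  have o3 := Occ.bounds (x := y) (n := j + 3)
  by_cases hl : Occ y j
  · have hj' := hj
    obtain ⟨⟨a, b, c⟩, d⟩ := hj
    by_cases hp : Occ y (j - 1)
    · have g := hg (j + 1)
      have h3 : Occ y (j + 3) := by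
        by_contra h3
        refine g ⟨⟨by omega, ?_, ?_⟩, ?_, ?_⟩ <;> grind
      exact better_of_left r hS hy h1 hN hg (j := j + 1) ⟨⟨by omega, by grind, by grind⟩, by grind⟩
        (by grind)
    · by_cases hj1 : j = 1
      · subst hj1
        have hmem := hS y hy _ (fastest_neut r h1 hN hg hj')
        have hb := hj'.blocks
        have h1' : ¬ Occ (sw 1 y) 1 := by rw [occ_sw]; grind
        have h2' : Occ (sw 1 y) 2 := by rw [occ_sw]; grind
        have e := blocks_fl _ (by omega) h1'
        rw [ind_true h2'] at e
        refine better_of_fill r hS hmem h1' (Or.inr ⟨by omega, Or.inl ?_⟩) fun h6 ht => ?_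
        · simp only [defect, occ_fl, occ_sw]
          grind
        · simp only [Tail, occ_fl, occ_sw] at *
          grind
      · have g := hg (j - 1)
        have e1 : j - 1 + 1 = j := by omega
        have e2 : j - 1 + 2 = j + 1 := by omega
        have e3 : j - 1 - 1 = j - 2 := by omega
        have h3 : ¬ Occ y (j - 2) := by
          intro h3
          refine g ⟨⟨by omega, by omega, ?_⟩, ?_, ?_⟩ <;> grind
        exact better_of_left r hS hy h1 hN hg (j := j - 1)
          ⟨⟨by omega, by omega, by grind⟩, by grind⟩ (by grind)
  · exact better_of_left r hS hy h1 hN hg hj hl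

/-- Two successive exchanges that shift a short block or a short gap. -/
theorem better_of_pair {y : Config N} {i j : ℕ} (hy : y ∈ S) (h1 : Occ y 1) (hN : ¬ Occ y N)
    (hN1 : ¬ Occ y (N - 1)) (hl : ∀ j, Iface j y → Loss j y) (hi : Iface i y)
    (hi2 : 2 ≤ i) (hj2 : 2 ≤ j) (hiN : i + 1 < N) (hil : ¬ Occ y i)
    (hj : Gain j (sw i y)) (hjl : ¬ Occ (sw i y) j) (hd : defect (sw j (sw i y)) ≤ defect y)
    (ht : Tail y → Tail (sw j (sw i y))) : Better S y := by
  have hN5 := r.five_le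
  have h := hS y hy _ (fastest_loss r h1 hN hN1 hl hi)
  have o1 : Occ (sw i y) 1 := by rw [occ_sw]; grind
  have oN : ¬ Occ (sw i y) N := by rw [occ_sw]; grind
  have h' := hS _ h _ (fastest_gain r o1 oN hj)
  have e1 := (hl i hi).blocks
  have e2 := hj.blocks
  have e3 := moment_sw y hi
  have e4 := moment_sw _ hj.1
  rw [if_neg hil] at e3
  rw [if_neg hjl] at e4
  refine ⟨_, h', ?_, Or.inr ⟨by omega, by omega⟩, fun _ => ht⟩
  have := hj.1.2.1
  rw [occ_sw]; grind

theorem better_of_short {y : Config N} (hy : y ∈ S) (h1 : Occ y 1) (hN : ¬ Occ y N)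
    (hN1 : ¬ Occ y (N - 1)) (hl : ∀ j, Iface j y → Loss j y) (h3 : ¬ Occ y 3) : Better S y := by
  have hN5 := r.five_le
  have h0 := not_occ_zero y
  have h2 : Occ y 2 := by
    by_contra h2
    exact h0 ((hl 1 ⟨le_rfl, by omega, by simp [h1, h2]⟩).2.2.2 h1)
  have hi : Iface 2 y := ⟨by omega, by omega, by simp [h2, h3]⟩
  have h4 : ¬ Occ y 4 := by
    have := (hl 2 hi).2.1
    tauto
  have hm := hS y hy _ (fastest_loss r h1 hN hN1 hl hi)
  have o1 : Occ (sw 2 y) 1 := by rw [occ_sw]; grind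
  have o2 : ¬ Occ (sw 2 y) 2 := by rw [occ_sw]; grind
  have o3 : Occ (sw 2 y) 3 := by rw [occ_sw]; grind
  have o0 := not_occ_zero (sw 2 y)
  have oN : ¬ Occ (sw 2 y) N := by rw [occ_sw]; grind
  have hj : Gain 1 (sw 2 y) := ⟨⟨by omega, by omega, by tauto⟩, by tauto, by tauto⟩
  have hm' := hS _ hm _ (fastest_gain r o1 oN hj)
  have p1 : ¬ Occ (sw 1 (sw 2 y)) 1 := by rw [occ_sw]; grind
  have p2 : Occ (sw 1 (sw 2 y)) 2 := by rw [occ_sw]; grind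
  have e1 := (hl 2 hi).blocks
  have e2 := hj.blocks
  have e3 := blocks_fl _ (by omega) p1
  rw [ind_true p2] at e3
  refine better_of_fill r hS hm' p1 (Or.inr ⟨by omega, Or.inl ?_⟩) fun h6 ht => ?_
  · simp only [defect, occ_fl, occ_sw]
    grind
  · simp only [Tail, occ_fl, occ_sw] at *
    grind

theorem stable_or_better {y : Config N} (hy : y ∈ S) (h1 : Occ y 1)
    (hT : (∀ j, Iface j y → Loss j y) → ¬ Occ y N → Occ y (N - 1) → Better S y) :
    Stable y ∨ Better S y := by
  have hN5 := r.five_le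
  by_cases hN : Occ y N
  · exact Or.inr (better_of_remove r hS hy h1 hN)
  by_cases hg : ∃ j, Gain j y
  · obtain ⟨j, hj⟩ := hg
    exact Or.inr (better_of_gain r hS hy h1 hj (fastest_gain r h1 hN hj))
  push Not at hg
  by_cases hn : ∃ j, Neut j y
  · obtain ⟨j, hj⟩ := hn
    exact Or.inr (better_of_neut r hS hy h1 hN hg hj)
  push Not at hn
  have hl : ∀ j, Iface j y → Loss j y := fun j hj => by
    rcases hj.cases with h | h | h
    · exact absurd h (hg j)
    · exact absurd h (hn j)
    · exact h
  by_cases hN1 : Occ y (N - 1)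
  · exact Or.inr (hT hl hN hN1)
  by_cases h3 : Occ y 3
  swap
  · exact Or.inr (better_of_short r hS hy h1 hN hN1 hl h3)
  have h2 : Occ y 2 := by
    by_contra h2
    exact not_occ_zero y ((hl 1 ⟨le_rfl, by omega, by simp [h1, h2]⟩).2.2.2 h1)
  have hN1' : N - 1 + 1 = N := by omega
  have hlt : ∀ n, Occ y n → n + 1 < N := fun n hn => by
    have := hn.bounds
    by_contra hc
    have : n = N ∨ n = N - 1 := by omega
    rcases this with rfl | rfl <;> contradiction
  by_cases hb : ∃ i, Occ y (i + 1) ∧ Occ y (i + 2) ∧ ¬ Occ y i ∧ ¬ Occ y (i + 3)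
  · obtain ⟨i, a, b, c, d⟩ := hb
    right
    have hi4 : 4 ≤ i := by
      by_contra hc
      interval_cases i <;> simp_all
    have hlb := hlt _ b
    have hi : Iface i y := ⟨by omega, by omega, by tauto⟩
    have hi' := hl i hi
    have hk := hl (i + 2) ⟨by omega, by omega, by tauto⟩
    have k1 : ¬ Occ y (i - 1) := by have := hi'.2.2; tauto
    have k2 : ¬ Occ y (i + 4) := by have := hk.2.1; grind
    refine better_of_pair r hS hy h1 hN hN1 hl (i := i) (j := i + 1) hi (by omega) (by omega)
      (by omega) c ⟨⟨by omega, by omega, ?_⟩, ?_, ?_⟩ ?_ ?_ ?_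
    · simp only [occ_sw]; grind
    · simp only [occ_sw]; grind
    · simp only [occ_sw]; grind
    · simp only [occ_sw]; grind
    · simp only [defect, occ_sw]; grind
    · intro ht
      simp only [Tail, occ_sw] at *
      grind
  by_cases hgap : ∃ i, Occ y i ∧ ¬ Occ y (i + 1) ∧ ¬ Occ y (i + 2) ∧ Occ y (i + 3)
  · obtain ⟨i, a, b, c, d⟩ := hgap
    right
    have hi4 : 3 ≤ i := by
      by_contra hc
      interval_cases i <;> simp_all
    have hlb := hlt _ d
    have hi : Iface (i + 2) y := ⟨by omega, by omega, by tauto⟩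
    have hi' := hl _ hi
    have hk := hl i ⟨by omega, by omega, by tauto⟩
    have k1 : Occ y (i - 1) := by have := hk.2.2; tauto
    have k2 : Occ y (i + 4) := by have := hi'.2.1; grind
    have hlc := hlt _ k2
    refine better_of_pair r hS hy h1 hN hN1 hl (i := i + 2) (j := i + 1) hi (by omega) (by omega)
      (by omega) c ⟨⟨by omega, by omega, ?_⟩, ?_, ?_⟩ ?_ ?_ ?_
    · simp only [occ_sw]; grind
    · simp only [occ_sw]; grind
    · simp only [occ_sw]; grind
    · simp only [occ_sw]; grind
    · simp only [defect, occ_sw]; grind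
    · intro ht
      simp only [Tail, occ_sw] at *
      grind
  left
  push Not at hb hgap
  exact ⟨h1, hN, hN1, hl, fun i a b => by by_contra! hc; exact hc.2 (hb i a b hc.1),
    fun i a b c d => hgap i a b c d⟩

end Kawasaki

namespace Kawasaki

variable {N : ℕ}

theorem occ_eta (p n : ℕ) : Occ (eta N p) n ↔ (1 ≤ n ∧ n ≤ N) ∧ n ≤ p := by
  constructor
  · rintro ⟨h1, h2, h3⟩
    simp only [eta, decide_eq_true_eq] at h3
    omega
  · rintro ⟨⟨h1, h2⟩, h3⟩
    refine ⟨by omega, h1, ?_⟩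
    simp only [eta, decide_eq_true_eq]
    omega

theorem occ_fr_of_ne (x : Config N) {n : ℕ} (h : n ≠ N) : Occ (fr x) n ↔ Occ x n := by
  rw [occ_fr, if_neg h]
  exact ⟨fun h => h.2, fun h => ⟨h.bounds, h⟩⟩

theorem occ_sw_of_ne (x : Config N) {j n : ℕ} (h : n ≠ j) (h' : n ≠ j + 1) :
    Occ (sw j x) n ↔ Occ x n := by
  rw [occ_sw, if_neg h, if_neg h']
  exact ⟨fun h => h.2, fun h => ⟨h.bounds, h⟩⟩

/-- Removal of the particle at site `l`. -/
noncomputable def erase (l : ℕ) (x : Config N) : Config N := ofPred N fun n => n ≠ l ∧ Occ x n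

/-- The particle at site `l` is moved to site `k`. -/
noncomputable def shift (l k : ℕ) (x : Config N) : Config N :=
  ofPred N fun n => n = k ∨ n ≠ l ∧ Occ x n

theorem occ_erase (l : ℕ) (x : Config N) (n : ℕ) :
    Occ (erase l x) n ↔ (1 ≤ n ∧ n ≤ N) ∧ n ≠ l ∧ Occ x n := occ_ofPred _ _

theorem occ_shift (l k : ℕ) (x : Config N) (n : ℕ) :
    Occ (shift l k x) n ↔ (1 ≤ n ∧ n ≤ N) ∧ (n = k ∨ n ≠ l ∧ Occ x n) := occ_ofPred _ _

variable [NeZero N] {κ μL μR : ℝ} {v : Config N → ℝ} (r : Regime N κ μL μR)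
include r

theorem fastest_remove_zero {x : Config N} (h1 : Occ x 1) (hN : Occ x N) (hN1 : ¬ Occ x (N - 1)) :
    Fastest κ μL μR x (fr x) := by
  rcases fastest_remove r h1 hN with h | ⟨j, hj, -, h⟩
  · exact h
  · have := h _ (allowed_fr x)
    rw [phi_fr_remove_zero r hN hN1, hj.phi] at this
    linarith [r.right]

theorem live_of_eq_zero {x : Config N} (hx : v x = 0) : Live κ μL μR v (-(κ / 2)) x := by
  have hN := r.five_le
  have := r.pos
  by_cases h1 : Occ x 1
  · by_cases h2 : Occ x N
    · exact ⟨fr x, allowed_fr x, by linarith [phi_fr_gt r h2]⟩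
    · obtain ⟨j, -, -, hj⟩ := exists_iface_of_not (x := x) le_rfl (by omega : 1 ≤ N) le_rfl
        (by simp [h1, h2])
      refine ⟨sw j x, allowed_sw hj, ?_⟩
      rcases hj.cases with h | h | h <;> rw [h.phi] <;> linarith
  · exact ⟨fl x, allowed_fl x, by linarith [lt_phi_fl r h1]⟩

variable (hv : IsRate κ μL μR v)
include hv

theorem Stable.eq_zero_of_live {y : Config N} (h : Stable y)
    (hl : Live κ μL μR v (-(κ / 2)) y) : v y = 0 := by
  refine le_antisymm (hv.nonpos y) ?_
  have := hl.le (phi_le_of_loss r h.first h.last h.pred h.loss)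
  linarith

/-- A configuration all of whose exchanges split blocks and which ends in `…10`, in the class of a
configuration of maximal rate, has itself maximal rate. -/
theorem nonneg_of_pred {x₀ y : Config N} (hx : v x₀ = 0)
    (hr : Reach κ μL μR v (-(κ / 2)) x₀ y) (h1 : Occ y 1) (hl : ∀ j, Iface j y → Loss j y)
    (hN : ¬ Occ y N) (hN1 : Occ y (N - 1)) : 0 ≤ v y := by
  have hN5 := r.five_le
  have hκ := r.pos
  have e1 : N - 1 + 1 = N := by omega
  have e2 : N - 1 - 1 = N - 2 := by omega
  have hN2 : Occ y (N - 2) := by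
    have := (hl (N - 1) ⟨by omega, by omega, by rw [e1]; tauto⟩).2.2
    rw [e2] at this
    tauto
  have f1 : Occ (fr y) 1 := by rw [occ_fr]; grind
  have fN : Occ (fr y) N := by rw [occ_fr]; grind
  have fN1 : Occ (fr y) (N - 1) := by rw [occ_fr]; grind
  have hback : 0 ≤ v (fr y) → 0 ≤ v y := fun h => by
    have hp := phi_fr_remove_one r fN fN1
    have hE : Edge κ μL μR v 0 (fr y) y := by
      refine ⟨(allowed_fr y).symm, ?_⟩
      rw [fr_fr] at hp
      linarith [r.right]
    have := (hE.live hv).le (c := 0) fun u hu => by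
      rcases allowed_iff.1 hu with ⟨j, hj, rfl⟩ | rfl | rfl
      · rw [(hl j hj).phi]; linarith
      · linarith [phi_fl_lt r h1]
      · linarith [phi_fr_lt r hN]
    linarith
  by_cases hT : x₀ = y ∨ x₀ = fr y
  · rcases hT with rfl | rfl
    · exact hx.ge
    · exact hback hx.ge
  · obtain ⟨a, ha, b, hb, hab⟩ := (hr.symm hv).exists_exit (A := {y, fr y}) (by simp)
      (by simpa using hT)
    simp only [Set.mem_insert_iff, Set.mem_singleton_iff, not_or] at ha hb
    rcases ha with rfl | rfl
    · have h := hab.2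
      rcases allowed_iff.1 hab.1 with ⟨j, hj, rfl⟩ | rfl | rfl
      · rw [(hl j hj).phi] at h; linarith
      · linarith [phi_fl_lt r h1]
      · exact absurd rfl hb.2
    · apply hback
      have h := hab.2
      rcases allowed_iff.1 hab.1 with ⟨j, hj, rfl⟩ | rfl | rfl
      · have hlj : Loss j (fr y) := by
          refine ⟨hj, ?_⟩
          obtain ⟨a, b, c⟩ := hj
          have h3 := hl j
          have : j + 1 ≤ N - 2 := by
            simp only [occ_fr] at c
            by_contra hc
            have : j = N - 2 ∨ j = N - 1 := by omega
            rcases this with rfl | rfl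
            · have e3 : N - 2 + 1 = N - 1 := by omega
              rw [e3] at c
              grind
            · rw [e1] at c
              grind
          have h4 := (h3 ⟨a, b, by
            rwa [occ_fr_of_ne y (by omega), occ_fr_of_ne y (by omega)] at c⟩).2
          rwa [occ_fr_of_ne y (by omega), occ_fr_of_ne y (by omega), occ_fr_of_ne y (by omega),
            occ_fr_of_ne y (by omega)]
        rw [hlj.phi] at h; linarith
      · linarith [phi_fl_lt r f1]
      · exact absurd (fr_fr y) hb.1

/-- Every configuration of maximal rate leads to a stable one. -/
theorem exists_stable {x₀ : Config N} (hx : v x₀ = 0) :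
    ∃ y, Stable y ∧ v y = 0 ∧ Reach κ μL μR v (-(κ / 2)) x₀ y := by
  have hN5 := r.five_le
  have hκ := r.pos
  have hS := maxClosed_reach hv (-(κ / 2)) x₀
  set S := {x | Live κ μL μR v (-(κ / 2)) x ∧ Reach κ μL μR v (-(κ / 2)) x₀ x}
  have hx0 : x₀ ∈ S := ⟨live_of_eq_zero r hx, Relation.ReflTransGen.refl⟩
  have hne : (S ∩ {y | Occ y 1}).Nonempty := by
    by_cases h1 : Occ x₀ 1
    · exact ⟨x₀, hx0, h1⟩
    · obtain ⟨z, hz, hz1, -⟩ := exists_fill r hS hx0 h1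
      exact ⟨z, hz, hz1⟩
  obtain ⟨y, ⟨hy, h1⟩, hmin⟩ := exists_minimal hne
  have hnb : ¬ Better S y := fun ⟨z, hz, hz1, hlow, _⟩ => hmin z ⟨hz, hz1⟩ hlow
  suffices hT : (∀ j, Iface j y → Loss j y) → ¬ Occ y N → Occ y (N - 1) → Better S y by
    have hst := (stable_or_better r hS hy h1 hT).resolve_right hnb
    exact ⟨y, hst, hst.eq_zero_of_live r hv hy.1, hy.2⟩
  intro hl hN hN1
  have e1 : N - 1 + 1 = N := by omega
  have h0 := nonneg_of_pred r hv hx hy.2 h1 hl hN hN1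
  have hi : Iface (N - 1) y := ⟨by omega, by omega, by rw [e1]; tauto⟩
  have hE : Edge κ μL μR v (-(κ / 2)) y (sw (N - 1) y) :=
    ⟨allowed_sw hi, by rw [(hl _ hi).phi]; linarith⟩
  have hmem : sw (N - 1) y ∈ S := ⟨hE.live hv, hy.2.trans hE.reach⟩
  have o1 : Occ (sw (N - 1) y) 1 := by rw [occ_sw]; grind
  have oN : Occ (sw (N - 1) y) N := by rw [occ_sw]; grind
  have oN1 : ¬ Occ (sw (N - 1) y) (N - 1) := by rw [occ_sw]; grind
  have hmem' := hS _ hmem _ (fastest_remove_zero r o1 oN oN1)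
  have b1 := (hl _ hi).blocks
  have b2 := blocks_fr _ (by omega) oN
  have m1 := moment_sw y hi
  have m2 := moment_fr _ oN
  rw [if_pos hN1] at m1
  rw [ind_false oN1] at b2
  refine ⟨_, hmem', ?_, Or.inr ⟨by omega, ?_⟩, fun _ ht => absurd hN1 ht.2.1⟩
  · rw [occ_fr]; grind
  · have : defect (fr (sw (N - 1) y)) = defect y := by
      simp only [defect, occ_fr, occ_sw]; grind
    omega

omit r hv [NeZero N] in
theorem Stable.tail_block (hN : 2 ≤ N) {y : Config N} (h : Stable y) {l : ℕ} (hl : Occ y l)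
    (hlast : ∀ n, l < n → ¬ Occ y n) :
    3 ≤ l ∧ l + 2 ≤ N ∧ Occ y (l - 1) ∧ Occ y (l - 2) ∧ Iface l y := by
  have h3 := h.three hN
  have h3l : 3 ≤ l := by by_contra hc; exact hlast 3 (by omega) h3
  have hb := hl.bounds
  have hlN : l + 2 ≤ N := by
    by_contra hc
    have : l = N ∨ l = N - 1 := by omega
    rcases this with rfl | rfl
    · exact h.last hl
    · exact h.pred hl
  have hi : Iface l y := ⟨by omega, by omega, by simp [hl, hlast (l + 1)]⟩
  have h1 : Occ y (l - 1) := (h.loss l hi).2.2.2 hl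
  refine ⟨h3l, hlN, h1, ?_, hi⟩
  have e1 : l - 2 + 1 = l - 1 := by omega
  have e2 : l - 2 + 2 = l := by omega
  have e3 : l - 2 + 3 = l + 1 := by omega
  have := h.block (l - 2)
  rw [e1, e2, e3] at this
  exact (this h1 hl).resolve_right (hlast _ (by omega))

theorem emission_step {y : Config N} (h : Stable y) (h0 : v y = 0) {l : ℕ} (hl : Occ y l)
    (hlast : ∀ n, l < n → ¬ Occ y n) {k : ℕ} (hk : l + 2 ≤ k) (hkN : k ≤ N) :
    Live κ μL μR v (-κ) (shift l k y) ∧ Reach κ μL μR v (-κ) y (shift l k y) ∧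
      blocks (shift l k y) = blocks y + 1 ∧ moment (shift l k y) = moment y + k - l := by
  have hN5 := r.five_le
  have hκ := r.pos
  obtain ⟨h3, hlN, p1, p2, hi⟩ := h.tail_block (by omega) hl hlast
  have h1 := h.first
  have hls : ∀ k, l < k → ∀ n, Occ (shift l k y) n ↔ n ≤ N ∧ (n = k ∨ n < l ∧ Occ y n) := by
    intro k hk n
    rw [occ_shift]
    have := hlast n
    have := Occ.bounds (x := y) (n := n)
    grind
  have hstep : ∀ k, l < k → k + 1 ≤ N → Neut k (shift l k y) ∧
      sw k (shift l k y) = shift l (k + 1) y := by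
    intro k h1 h2
    refine ⟨⟨⟨by omega, h2, ?_⟩, ?_⟩, ext_occ fun n _ _ => ?_⟩
    · simp only [hls k h1]; grind
    · simp only [hls k h1]; grind
    · simp only [occ_sw, hls k h1, hls (k + 1) (by omega)]; grind
  induction k, hk using Nat.le_induction with
  | base =>
    have e0 : sw l y = shift l (l + 1) y := by
      refine ext_occ fun n _ _ => ?_
      rw [occ_sw, hls _ (by omega)]
      have := hlast n
      have := hlast (l + 1)
      grind
    have hE : Edge κ μL μR v (-(κ / 2)) y (shift l (l + 1) y) := by
      rw [← e0]
      refine ⟨allowed_sw hi, ?_⟩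
      rw [(h.loss l hi).phi]; linarith
    obtain ⟨n1, n2⟩ := hstep (l + 1) (by omega) (by omega)
    have hlow := (hE.live hv).le (phi_le_half r (by rw [hls _ (by omega)]; grind)
      (by rw [hls _ (by omega)]; grind))
    have hE2 : Edge κ μL μR v (-κ) (shift l (l + 1) y) (shift l (l + 2) y) := by
      rw [← n2]
      refine ⟨allowed_sw n1.1, ?_⟩
      rw [n1.phi]; linarith
    refine ⟨hE2.live hv, (hE.mono (by linarith)).reach.trans hE2.reach, ?_, ?_⟩
    · rw [← n2, n1.blocks, ← e0, (h.loss l hi).blocks]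
    · rw [← n2, moment_sw _ n1.1, ← e0, moment_sw _ hi, if_pos hl, if_pos]
      · push_cast; ring
      · rw [e0, hls _ (by omega)]; grind
  | succ k hk ih =>
    obtain ⟨a, b, c, d⟩ := ih (by omega)
    obtain ⟨n1, n2⟩ := hstep k (by omega) (by omega)
    have hng : ∀ j, ¬ Gain j (shift l k y) := by
      rintro j ⟨⟨g1, g2, g3⟩, g4, g5⟩
      have hlj := h.loss j
      simp only [hls k (by omega)] at g3 g4 g5
      simp only [Iface, Loss] at hlj
      have := not_occ_zero y
      have := hlast (j + 1)
      have := hlast (j + 2)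
      have : j + 3 ≤ l ∨ j + 2 = l ∨ j + 1 = l ∨ l ≤ j := by omega
      grind
    have hm := fastest_neut r (x := shift l k y) (by rw [hls _ (by omega)]; grind)
      (by rw [hls _ (by omega)]; grind) hng n1
    rw [n2] at hm
    have hE := a.edge hm
    refine ⟨hE.live hv, b.trans hE.reach, ?_, ?_⟩
    · rw [← n2, n1.blocks, c]
    · rw [← n2, moment_sw _ n1.1, if_pos, d]
      · push_cast; ring
      · rw [hls _ (by omega)]; grind

/-- A stable configuration of maximal rate can emit its last particle to the right. -/
theorem emission {y : Config N} (h : Stable y) (h0 : v y = 0) {l : ℕ} (hl : Occ y l)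
    (hlast : ∀ n, l < n → ¬ Occ y n) :
    Live κ μL μR v (-κ) (erase l y) ∧ Reach κ μL μR v (-κ) y (erase l y) ∧
      blocks (erase l y) = blocks y ∧ moment (erase l y) = moment y - l := by
  have hN5 := r.five_le
  obtain ⟨h3, hlN, p1, p2, hi⟩ := h.tail_block (by omega) hl hlast
  obtain ⟨a, b, c, d⟩ := emission_step r hv h h0 hl hlast hlN le_rfl
  have h1 := h.first
  have hN := h.last
  have hN1 := h.pred
  have o1 : Occ (shift l N y) 1 := by rw [occ_shift]; grind
  have oN : Occ (shift l N y) N := by rw [occ_shift]; grind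
  have oN1 : ¬ Occ (shift l N y) (N - 1) := by rw [occ_shift]; grind
  have he : fr (shift l N y) = erase l y := by
    refine ext_occ fun n _ _ => ?_
    simp only [occ_fr, occ_shift, occ_erase]
    grind
  have hE := a.edge (fastest_remove_zero r o1 oN oN1)
  have e1 := blocks_fr _ (by omega) oN
  have e2 := moment_fr _ oN
  rw [ind_false oN1] at e1
  rw [he] at hE e1 e2
  exact ⟨hE.live hv, b.trans hE.reach, by omega, by omega⟩

omit r hv [NeZero N] in
theorem Stable.not_gain {y : Config N} (h : Stable y) (hN : 2 ≤ N) {j k : ℕ} (hj : Iface j y)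
    (hk : Gain k (sw j y)) : k = j := by
  have h1 := h.first
  have h2 := h.two hN
  have h3 := h.three hN
  have hlj := h.loss j hj
  have hlk := h.loss k
  obtain ⟨⟨a, b, c⟩, d, e⟩ := hk
  obtain ⟨⟨_, hjN, i3⟩, i4, i5⟩ := hlj
  have hj3 : 3 ≤ j := by
    by_contra hc
    have : j = 1 ∨ j = 2 := by omega
    rcases this with rfl | rfl <;> simp_all
  have b1 := h.block (j - 2)
  have b2 := h.block j
  have b3 := h.gap (j - 2)
  have b4 := h.gap j
  have e1 : j - 2 + 1 = j - 1 := by omega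
  have e2 : j - 2 + 2 = j := by omega
  have e3 : j - 2 + 3 = j + 1 := by omega
  rw [e1, e2, e3] at b1 b3
  simp only [Iface, Loss] at hlk
  by_contra hne
  have := Occ.bounds (x := y) (n := j + 2)
  have := Occ.bounds (x := y) (n := j + 3)
  have := Occ.bounds (x := y) (n := k + 2)
  have := Occ.bounds (x := y) (n := k - 1)
  simp only [occ_sw] at c d e
  have : k + 3 ≤ j ∨ k + 2 = j ∨ k + 1 = j ∨ k = j + 1 ∨ k = j + 2 ∨ j + 3 ≤ k := by omega
  rcases this with hh | hh | hh | hh | hh | hh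
  · grind
  · grind
  · grind
  · grind
  · grind
  · grind

end Kawasaki

namespace Kawasaki

variable {N : ℕ}

theorem Loss.gain_sw {j : ℕ} {x : Config N} (h : Loss j x) : Gain j (sw j x) := by
  refine ⟨h.1.sw, ?_⟩
  obtain ⟨⟨a, b, c⟩, d, e⟩ := h
  have o1 := Occ.bounds (x := x) (n := j + 2)
  have o2 := Occ.bounds (x := x) (n := j - 1)
  simp only [occ_sw]
  grind

/-- If the last three sites of a stable configuration are empty, then after an insertion at the last
site no exchange merges two blocks. -/
theorem Stable.not_gain_fr {y : Config N} (h : Stable y) (hN : 5 ≤ N) (ht : Tail y) (k : ℕ) :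
    ¬ Gain k (fr y) := by
  intro hk
  obtain ⟨t1, t2, t3⟩ := ht
  obtain ⟨⟨a, b, c⟩, d, e⟩ := hk
  have : k = N - 1 ∨ k = N - 2 ∨ k + 3 ≤ N := by omega
  rcases this with rfl | rfl | hk
  · have e1 : N - 1 + 1 = N := by omega
    have e2 : N - 1 - 1 = N - 2 := by omega
    rw [e1, e2, occ_fr_of_ne y (by omega)] at e
    exact t3 (e.2 (by rw [occ_fr]; simp [t1]; omega))
  · have e1 : N - 2 + 1 = N - 1 := by omega
    rw [e1, occ_fr_of_ne y (by omega), occ_fr_of_ne y (by omega)] at c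
    tauto
  · rw [occ_fr_of_ne y (by omega), occ_fr_of_ne y (by omega)] at c d e
    have := (h.loss k ⟨a, b, c⟩).2
    tauto

variable [NeZero N] {κ μL μR : ℝ} {v : Config N → ℝ} (r : Regime N κ μL μR)
  (hv : IsRate κ μL μR v)
include r hv

/-- A stable configuration ending with three holes which is connected at level `-κ` to a
configuration of maximal rate has maximal rate. -/
theorem Stable.eq_zero_of_reach {x₀ y : Config N} (hx : v x₀ = 0) (h : Stable y) (ht : Tail y)
    (hr : Reach κ μL μR v (-κ) x₀ y) : v y = 0 := by
  have hN := r.five_le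
  have hκ := r.pos
  have h1 := h.first
  have h2 := h.two (by omega)
  obtain ⟨t1, t2, t3⟩ := id ht
  have hsw : ∀ j, Iface j y → -κ ≤ v (sw j y) → v y = 0 := fun j hj hle => by
    refine h.eq_zero_of_live r hv (Edge.live (x := sw j y) hv ⟨?_, ?_⟩)
    · exact (allowed_sw hj).symm
    · have := (h.loss j hj).gain_sw.phi (κ := κ) (μL := μL) (μR := μR)
      rw [sw_sw hj] at this
      linarith
  have hfr : -κ ≤ v (fr y) → v y = 0 := fun hle => by
    refine h.eq_zero_of_live r hv (Edge.live (x := fr y) hv ⟨(allowed_fr y).symm, ?_⟩)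
    have := phi_fr_remove_zero r (x := fr y) (by rw [occ_fr]; simp [t1]; omega)
      (by rwa [occ_fr_of_ne y (by omega)])
    rw [fr_fr] at this
    linarith [r.right]
  have hI : ∀ j, Iface j y → 2 ≤ j ∧ j + 1 ≠ N := fun j hj => by
    obtain ⟨a, b, c⟩ := hj
    refine ⟨?_, fun hc => ?_⟩
    · by_contra hc
      obtain rfl : j = 1 := by omega
      tauto
    · obtain rfl : j = N - 1 := by omega
      rw [hc] at c
      tauto
  by_cases hA : x₀ = y ∨ (∃ j, Iface j y ∧ x₀ = sw j y) ∨ x₀ = fr y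
  · rcases hA with rfl | ⟨j, hj, rfl⟩ | rfl
    · exact hx
    · exact hsw j hj (by linarith)
    · exact hfr (by linarith)
  · obtain ⟨a, ha, b, hb, hab, hle⟩ := (hr.symm hv).exists_exit
      (A := {z | z = y ∨ (∃ j, Iface j y ∧ z = sw j y) ∨ z = fr y}) (Or.inl rfl) hA
    simp only [Set.mem_ofPred_eq, not_or] at ha hb
    obtain ⟨hb1, hb2, hb3⟩ := hb
    rcases ha with rfl | ⟨j, hj, rfl⟩ | rfl
    · rcases allowed_iff.1 hab with ⟨j, hj, rfl⟩ | rfl | rfl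
      · exact absurd ⟨j, hj, rfl⟩ hb2
      · linarith [phi_fl_lt_of_two r h1 h2, hv.nonpos a]
      · exact absurd rfl hb3
    · refine hsw j hj ?_
      obtain ⟨j1, j2⟩ := hI j hj
      have o1 : Occ (sw j y) 1 := (occ_sw_of_ne y (by omega) (by omega)).2 h1
      have oN : ¬ Occ (sw j y) N := by
        rw [occ_sw_of_ne y (by have := hj.2.1; omega) (by omega)]
        exact t1
      rcases hab.cases with ⟨k, hk, rfl⟩ | ⟨k, hk, rfl⟩ | ⟨k, hk, rfl⟩ | rfl | rfl
      · obtain rfl := h.not_gain (by omega) hj hk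
        exact absurd (sw_sw hj) hb1
      · rw [hk.phi] at hle; linarith
      · rw [hk.phi] at hle; linarith
      · linarith [phi_fl_lt r o1]
      · linarith [phi_fr_lt r oN]
    · refine hfr ?_
      have o1 : Occ (fr y) 1 := (occ_fr_of_ne y (by omega)).2 h1
      rcases hab.cases with ⟨k, hk, rfl⟩ | ⟨k, hk, rfl⟩ | ⟨k, hk, rfl⟩ | rfl | rfl
      · exact absurd hk (h.not_gain_fr hN ht k)
      · rw [hk.phi] at hle; linarith
      · rw [hk.phi] at hle; linarith
      · linarith [phi_fl_lt r o1]
      · exact absurd (fr_fr y) hb1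

omit r hv [NeZero N] in
theorem exists_last {x : Config N} (h : Occ x 1) : ∃ l, Occ x l ∧ ∀ n, l < n → ¬ Occ x n := by
  have hs : ((Finset.Icc 1 N).filter (Occ x)).Nonempty := ⟨1, by simp [h, h.bounds.2]⟩
  refine ⟨_, (Finset.mem_filter.1 (Finset.max'_mem _ hs)).2, fun n hn ho => ?_⟩
  exact absurd (Finset.le_max' _ n (Finset.mem_filter.2 ⟨Finset.mem_Icc.2 ho.bounds, ho⟩))
    (not_le.2 hn)

omit r hv [NeZero N] in
/-- A stable configuration is a packed block at the left or has at least five sites up to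
its last particle. -/
theorem Stable.eta_or (hN : 2 ≤ N) {y : Config N} (h : Stable y) {l : ℕ} (hl : Occ y l)
    (hlast : ∀ n, l < n → ¬ Occ y n) : y = eta N l ∨ 5 ≤ l := by
  obtain ⟨h3, hlN, p1, p2, hi⟩ := h.tail_block hN hl hlast
  by_cases h5 : 5 ≤ l
  · exact Or.inr h5
  · refine Or.inl (ext_occ fun n hn _ => ?_)
    have o1 := h.first
    have o2 := h.two hN
    have o3 := h.three hN
    rw [occ_eta]
    have := hlast n
    have : n = 1 ∨ n = 2 ∨ n = 3 ∨ n = l ∨ l < n := by omega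
    grind

/-- Every configuration of maximal rate is connected at level `-κ` to a packed configuration of
maximal rate. -/
theorem exists_eta {x : Config N} (hx : v x = 0) :
    ∃ p, 3 ≤ p ∧ p + 2 ≤ N ∧ v (eta N p) = 0 ∧ Reach κ μL μR v (-κ) x (eta N p) := by
  have hN := r.five_le
  have hκ := r.pos
  obtain ⟨y, hy, hy0, hr⟩ := exists_stable r hv hx
  replace hr := hr.mono (ℓ' := -κ) (by linarith)
  obtain ⟨l, hl, hlast⟩ := exists_last hy.first
  have htb := hy.tail_block (by omega) hl hlast
  rcases hy.eta_or (by omega) hl hlast with rfl | h5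
  · exact ⟨l, htb.1, htb.2.1, hy0, hr⟩
  have h6 : 6 ≤ N := by omega
  have hS := maxClosed_reach hv (-κ) x
  set S := {z | Live κ μL μR v (-κ) z ∧ Reach κ μL μR v (-κ) x z}
  have hmem : ∀ {y l}, Stable y → v y = 0 → Reach κ μL μR v (-κ) x y → Occ y l →
      (∀ n, l < n → ¬ Occ y n) → 5 ≤ l → erase l y ∈ S ∩ {z | Occ z 1 ∧ Tail z} := by
    intro y l hy hy0 hr hl hlast h5
    obtain ⟨a, b, -, -⟩ := emission r hv hy hy0 hl hlast
    have htb := hy.tail_block (by omega) hl hlast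
    refine ⟨⟨a, hr.trans b⟩, ?_, ?_⟩
    · rw [occ_erase]
      exact ⟨by omega, by omega, hy.first⟩
    · have := hlast (N - 1)
      have := hlast (N - 2)
      have := hlast N
      simp only [Tail, occ_erase]
      grind
  obtain ⟨y₂, ⟨hS₂, h1, ht⟩, hmin⟩ := exists_minimal ⟨_, hmem hy hy0 hr hl hlast h5⟩
  have hst : Stable y₂ := by
    refine (stable_or_better r hS hS₂ h1 fun _ _ h => absurd h ht.2.1).resolve_right ?_
    rintro ⟨z, hz, hz1, hlow, hzt⟩
    exact hmin z ⟨hz, hz1, hzt h6 ht⟩ hlow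
  have h0 := hst.eq_zero_of_reach r hv hx ht hS₂.2
  obtain ⟨l, hl, hlast⟩ := exists_last h1
  have htb := hst.tail_block (by omega) hl hlast
  rcases hst.eta_or (by omega) hl hlast with rfl | h5
  · exact ⟨l, htb.1, htb.2.1, h0, hS₂.2⟩
  refine absurd ?_ (hmin _ (hmem hst h0 hS₂.2 hl hlast h5))
  obtain ⟨-, -, b, m⟩ := emission r hv hst h0 hl hlast
  refine Or.inr ⟨b, Or.inr ⟨?_, by omega⟩⟩
  simp only [defect, occ_erase]
  grind

end Kawasaki

namespace Kawasaki

variable {N : ℕ}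

/-- The configuration with blocks `1, …, a` and `a + k + 1, …, a + k + c`. -/
noncomputable def fam (N a k c : ℕ) : Config N :=
  ofPred N fun n => n ≤ a ∨ a + k < n ∧ n ≤ a + k + c

theorem occ_fam (a k c n : ℕ) :
    Occ (fam N a k c) n ↔ (1 ≤ n ∧ n ≤ N) ∧ (n ≤ a ∨ a + k < n ∧ n ≤ a + k + c) := occ_ofPred _ _

/-- A packed configuration together with the two configurations obtained by moving its last
particle one step and by inserting a particle at the last site. -/
def Core (p : ℕ) (x : Config N) : Prop :=
  x = eta N p ∨ x = fam N (p - 1) 1 1 ∨ x = fr (eta N p)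

/-- The traps: the cores of the packed configurations, and the two fullest packed configurations. -/
def Trap (x : Config N) : Prop :=
  (∃ p, 3 ≤ p ∧ p + 2 ≤ N ∧ Core p x) ∨ x = eta N (N - 1) ∨ x = eta N N

/-- The configurations on the paths between the traps. -/
inductive Passage : Config N → Prop
  | insert (c : ℕ) (h : 2 ≤ c) (h' : c + 2 ≤ N) : Passage (fam N 0 1 c)
  | hole (a c : ℕ) (h : 1 ≤ a) (h1 : 1 ≤ c) (h2 : a = 1 ∨ 2 ≤ c) (h' : a + c + 2 ≤ N) :
    Passage (fam N a 1 c)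
  | particle (a k : ℕ) (h : 2 ≤ a) (h1 : 2 ≤ k) (h' : a + k + 2 ≤ N) : Passage (fam N a k 1)
  | remove (h : 5 ≤ N) : Passage (fr (eta N 2))
  | pair (h : 5 ≤ N) : Passage (eta N 2)

theorem sw_eta {p : ℕ} (h : 1 ≤ p) (h' : p + 1 ≤ N) : sw p (eta N p) = fam N (p - 1) 1 1 := by
  refine ext_occ fun n _ _ => ?_
  simp only [occ_sw, occ_eta, occ_fam]
  grind

theorem sw_fam_one {p : ℕ} (h : 1 ≤ p) (h' : p + 1 ≤ N) :
    sw p (fam N (p - 1) 1 1) = eta N p := by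
  refine ext_occ fun n _ _ => ?_
  simp only [occ_sw, occ_eta, occ_fam]
  grind

theorem sw_hole_left (a c : ℕ) (h : 1 ≤ a) :
    sw a (fam N a 1 c) = fam N (a - 1) 1 (c + 1) := by
  refine ext_occ fun n _ _ => ?_
  simp only [occ_sw, occ_fam]
  grind

theorem sw_hole_right (a c : ℕ) (hc : 1 ≤ c) (h' : a + c + 1 ≤ N) :
    sw (a + 1) (fam N a 1 c) = fam N (a + 1) 1 (c - 1) := by
  refine ext_occ fun n _ _ => ?_
  simp only [occ_sw, occ_fam]
  grind

theorem sw_particle_left (a k : ℕ) (hk : 2 ≤ k) (h' : a + k + 1 ≤ N) :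
    sw (a + k) (fam N a k 1) = fam N a (k - 1) 1 := by
  refine ext_occ fun n _ _ => ?_
  simp only [occ_sw, occ_fam]
  grind

theorem sw_particle_right (a k : ℕ) (h' : a + k + 2 ≤ N) :
    sw (a + k + 1) (fam N a k 1) = fam N a (k + 1) 1 := by
  refine ext_occ fun n _ _ => ?_
  simp only [occ_sw, occ_fam]
  grind

theorem fam_last (a k : ℕ) (h1 : 1 ≤ k) (h : a + k + 1 = N) : fam N a k 1 = fr (eta N a) := by
  refine ext_occ fun n _ _ => ?_
  simp only [occ_fr, occ_eta, occ_fam]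
  grind

theorem fl_fam (c : ℕ) : fl (fam N 0 1 c) = eta N (c + 1) := by
  refine ext_occ fun n _ _ => ?_
  simp only [occ_fl, occ_eta, occ_fam]
  grind

theorem iface_eta {j p : ℕ} : Iface j (eta N p) ↔ j = p ∧ 1 ≤ p ∧ p + 1 ≤ N := by
  simp only [Iface, occ_eta]
  omega

theorem loss_eta {p : ℕ} (h : 2 ≤ p) (h' : p + 1 ≤ N) : Loss p (eta N p) := by
  simp only [Loss, Iface, occ_eta]
  omega

section transitions

variable [NeZero N] {κ μL μR : ℝ} {v : Config N → ℝ} (r : Regime N κ μL μR)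
include r

theorem eta_cases {p : ℕ} (hp : 2 ≤ p) (hpN : p ≤ N) {y : Config N} (h : Allowed (eta N p) y) :
    (p + 1 ≤ N ∧ y = fam N (p - 1) 1 1 ∧ phi κ μL μR (eta N p) y = -(κ / 2)) ∨
      phi κ μL μR (eta N p) y < -κ ∨ y = fr (eta N p) := by
  have hN := r.five_le
  rcases allowed_iff.1 h with ⟨j, hj, rfl⟩ | rfl | rfl
  · obtain ⟨rfl, -, h1⟩ := iface_eta.1 hj
    exact Or.inl ⟨h1, sw_eta (by omega) h1, (loss_eta hp h1).phi⟩
  · exact Or.inr (Or.inl (phi_fl_lt_of_two r (by rw [occ_eta]; omega) (by rw [occ_eta]; omega)))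
  · exact Or.inr (Or.inr rfl)

theorem phi_eta_le {p : ℕ} (hp : 2 ≤ p) (hpN : p + 2 ≤ N) {y : Config N}
    (h : Allowed (eta N p) y) : phi κ μL μR (eta N p) y ≤ -(κ / 2) := by
  refine phi_le_of_loss r ?_ ?_ ?_ (fun j hj => ?_) y h
  · rw [occ_eta]; omega
  · rw [occ_eta]; omega
  · rw [occ_eta]; omega
  · obtain ⟨rfl, -, -⟩ := iface_eta.1 hj
    exact loss_eta hp (by omega)

theorem core_cases {p : ℕ} (hp : 3 ≤ p) (hpN : p + 2 ≤ N) {y : Config N}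
    (h : Allowed (fam N (p - 1) 1 1) y) :
    y = eta N p ∨ phi κ μL μR (fam N (p - 1) 1 1) y < 0 ∨
      phi κ μL μR (fam N (p - 1) 1 1) y = 0 ∧
        (y = fam N (p - 2) 1 2 ∨ y = fam N (p - 1) 2 1) := by
  have hκ := r.pos
  have hN := r.five_le
  rcases h.cases with ⟨j, hj, rfl⟩ | ⟨j, hj, rfl⟩ | ⟨j, hj, rfl⟩ | rfl | rfl
  · simp only [Gain, Iface, occ_fam] at hj
    obtain rfl : j = p := by omega
    exact Or.inl (sw_fam_one (by omega) (by omega))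
  · refine Or.inr (Or.inr ⟨hj.phi, ?_⟩)
    simp only [Neut, Iface, occ_fam] at hj
    have : j = p - 1 ∨ j = p - 1 + 1 + 1 := by omega
    rcases this with rfl | rfl
    · exact Or.inl (sw_hole_left _ _ (by omega))
    · exact Or.inr (sw_particle_right _ _ (by omega))
  · rw [hj.phi]
    exact Or.inr (Or.inl (by linarith))
  · refine Or.inr (Or.inl ?_)
    linarith [phi_fl_lt r (x := fam N (p - 1) 1 1) (by rw [occ_fam]; omega)]
  · exact Or.inr (Or.inl (phi_fr_lt r (by rw [occ_fam]; omega)))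

theorem fr_eta_cases {p : ℕ} (hp : 2 ≤ p) (hpN : p + 2 ≤ N) {y : Config N}
    (h : Allowed (fr (eta N p)) y) :
    y = eta N p ∨ phi κ μL μR (fr (eta N p)) y ≤ 0 ∨
      phi κ μL μR (fr (eta N p)) y = κ / 2 ∧ p + 2 = N ∧ y = eta N (N - 1) := by
  have hκ := r.pos
  have hN := r.five_le
  rcases h.cases with ⟨j, hj, rfl⟩ | ⟨j, hj, rfl⟩ | ⟨j, hj, rfl⟩ | rfl | rfl
  · refine Or.inr (Or.inr ⟨hj.phi, ?_⟩)
    have hj' : p + 2 = N ∧ j = N - 1 := by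
      rw [← fam_last p (N - p - 1) (by omega) (by omega)] at hj
      simp only [Gain, Iface, occ_fam] at hj
      omega
    obtain ⟨h1, rfl⟩ := hj'
    refine ⟨h1, ext_occ fun n _ _ => ?_⟩
    simp only [occ_sw, occ_fr, occ_eta]
    grind
  · exact Or.inr (Or.inl hj.phi.le)
  · rw [hj.phi]
    exact Or.inr (Or.inl (by linarith))
  · refine Or.inr (Or.inl ?_)
    linarith [phi_fl_lt r (x := fr (eta N p)) (by simp only [occ_fr, occ_eta]; grind)]
  · exact Or.inl (fr_fr _)

theorem phi_eta_pred_le {y : Config N} (h : Allowed (eta N (N - 1)) y) :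
    phi κ μL μR (eta N (N - 1)) y ≤ 0 := by
  have hN := r.five_le
  refine phi_le_of_not_gain r ?_ ?_ (fun j hj => ?_) y h
  · rw [occ_eta]; omega
  · rw [occ_eta]; omega
  · simp only [Gain, Iface, occ_eta] at hj
    omega

omit r [NeZero N] in
theorem fam_eq_fr (hN : 3 ≤ N) : fam N (N - 1 - 1) 1 1 = fr (eta N (N - 2)) := by
  rw [fam_last _ _ le_rfl (by omega)]
  rfl

omit r [NeZero N] in
theorem fr_eta_pred (hN : 1 ≤ N) : fr (eta N (N - 1)) = eta N N := by
  refine ext_occ fun n _ _ => ?_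
  simp only [occ_fr, occ_eta]
  grind

end transitions

end Kawasaki

namespace Kawasaki

variable {N : ℕ}

theorem trap_or_passage_particle [NeZero N] (hN : 5 ≤ N) {a k : ℕ} (ha : 2 ≤ a) (hk : 1 ≤ k)
    (h : a + k + 1 ≤ N) : Trap (fam N a k 1) ∨ Passage (fam N a k 1) := by
  rcases eq_or_lt_of_le h with h | h
  · rw [fam_last a k hk h]
    rcases eq_or_lt_of_le ha with rfl | ha
    · exact Or.inr (.remove hN)
    · exact Or.inl (Or.inl ⟨a, ha, by omega, Or.inr (Or.inr rfl)⟩)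
  · by_cases hk1 : k = 1
    · subst hk1
      exact Or.inl (Or.inl ⟨a + 1, by omega, by omega, Or.inr (Or.inl rfl)⟩)
    · exact Or.inr (.particle a k ha (by omega) (by omega))

theorem trap_or_passage_hole [NeZero N] {a c : ℕ} (ha : 1 ≤ a) (hc : 1 ≤ c)
    (h : a + c + 2 ≤ N) : Trap (fam N a 1 c) ∨ Passage (fam N a 1 c) := by
  by_cases h2 : a = 1 ∨ 2 ≤ c
  · exact Or.inr (.hole a c ha hc h2 h)
  · obtain rfl : c = 1 := by omega
    exact Or.inl (Or.inl ⟨a + 1, by omega, by omega, Or.inr (Or.inl rfl)⟩)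

variable [NeZero N] {κ μL μR : ℝ} {v : Config N → ℝ} (r : Regime N κ μL μR)
include r

theorem Fastest.eq_fl {x y : Config N} (h : Fastest κ μL μR x y) (h1 : ¬ Occ x 1)
    (hN : ¬ Occ x N) : y = fl x := by
  have h2 := h.2 _ (allowed_fl x)
  have h3 := lt_phi_fl r h1
  have := r.pos
  rcases h.1.cases with ⟨j, hj, rfl⟩ | ⟨j, hj, rfl⟩ | ⟨j, hj, rfl⟩ | rfl | rfl
  · rw [hj.phi] at h2; linarith
  · rw [hj.phi] at h2; linarith
  · rw [hj.phi] at h2; linarith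
  · rfl
  · linarith [phi_fr_lt r hN]

theorem Fastest.eq_gain {x y : Config N} (h : Fastest κ μL μR x y) (h1 : Occ x 1)
    (hN : ¬ Occ x N) {j : ℕ} (hj : Gain j x) : ∃ k, Gain k x ∧ y = sw k x := by
  have h2 := h.2 _ (allowed_sw hj.1)
  rw [hj.phi] at h2
  have := r.pos
  rcases h.1.cases with ⟨k, hk, rfl⟩ | ⟨k, hk, rfl⟩ | ⟨k, hk, rfl⟩ | rfl | rfl
  · exact ⟨k, hk, rfl⟩
  · rw [hk.phi] at h2; linarith
  · rw [hk.phi] at h2; linarith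
  · linarith [phi_fl_lt r h1]
  · linarith [phi_fr_lt r hN]

theorem Fastest.eq_neut {x y : Config N} (h : Fastest κ μL μR x y) (h1 : Occ x 1)
    (hN : ¬ Occ x N) (hg : ∀ j, ¬ Gain j x) {j : ℕ} (hj : Neut j x) :
    ∃ k, Neut k x ∧ y = sw k x := by
  have h2 := h.2 _ (allowed_sw hj.1)
  rw [hj.phi] at h2
  have := r.pos
  rcases h.1.cases with ⟨k, hk, rfl⟩ | ⟨k, hk, rfl⟩ | ⟨k, hk, rfl⟩ | rfl | rfl
  · exact absurd hk (hg k)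
  · exact ⟨k, hk, rfl⟩
  · rw [hk.phi] at h2; linarith
  · linarith [phi_fl_lt r h1]
  · linarith [phi_fr_lt r hN]

theorem fastest_pair : Fastest κ μL μR (eta N 2) (fam N 1 1 1) := by
  have hN := r.five_le
  have h := loss_eta (N := N) (p := 2) le_rfl (by omega)
  have e := sw_eta (N := N) (p := 2) (by omega) (by omega)
  refine ⟨e ▸ allowed_sw h.1, fun u hu => ?_⟩
  have := h.phi (κ := κ) (μL := μL) (μR := μR)
  rw [e] at this
  rw [this]
  exact phi_eta_le r le_rfl (by omega) hu

theorem phi_fr_eta {p : ℕ} (hp : p + 2 ≤ N) :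
    phi κ μL μR (fr (eta N p)) (eta N p) = -(μR / 2) := by
  have h := phi_fr_remove_zero r (x := fr (eta N p)) ?_ ?_
  · rwa [fr_fr] at h
  · simp only [occ_fr, occ_eta]
    grind
  · simp only [occ_fr, occ_eta]
    grind

theorem fastest_fr_eta {p : ℕ} (hp : 2 ≤ p) (hpN : p + 2 ≤ N) {y : Config N} :
    Fastest κ μL μR (fr (eta N p)) y ↔ y = eta N p := by
  have hφ := phi_fr_eta r hpN
  have hκ := r.pos
  have hR := r.right
  constructor
  · intro h
    have h2 := h.2 _ (allowed_fr (eta N p)).symm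
    rcases fr_eta_cases r hp hpN h.1 with h | h | h
    · exact h
    · linarith
    · linarith [h.1]
  · rintro rfl
    refine ⟨(allowed_fr _).symm, fun u hu => ?_⟩
    rcases fr_eta_cases r hp hpN hu with rfl | h | h
    · rfl
    · linarith
    · linarith [h.1]

theorem fastest_hole {a c : ℕ} (ha : 1 ≤ a) (hc : 1 ≤ c) (h2 : a = 1 ∨ 2 ≤ c)
    (h : a + c + 2 ≤ N) : Fastest κ μL μR (fam N a 1 c) (fam N (a - 1) 1 (c + 1)) := by
  have hN := r.five_le
  rw [← sw_hole_left a c ha]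
  have o1 : Occ (fam N a 1 c) 1 := by rw [occ_fam]; omega
  have oN : ¬ Occ (fam N a 1 c) N := by rw [occ_fam]; omega
  by_cases h1 : a = 1
  · subst h1
    refine fastest_gain r o1 oN ?_
    simp only [Gain, Iface, occ_fam]; omega
  · refine fastest_neut r o1 oN (fun j hj => ?_) ?_
    · simp only [Gain, Iface, occ_fam] at hj; omega
    · simp only [Neut, Iface, occ_fam]; omega

theorem fastest_insert {c : ℕ} (h : c + 2 ≤ N) :
    Fastest κ μL μR (fam N 0 1 c) (eta N (c + 1)) := by
  rw [← fl_fam c]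
  refine fastest_fill r ?_ ?_
  · rw [occ_fam]; omega
  · rw [occ_fam]; omega

theorem fastest_particle {a k : ℕ} (ha : 2 ≤ a) (hk : 2 ≤ k) (h : a + k + 2 ≤ N) :
    Fastest κ μL μR (fam N a k 1) (fam N a (k - 1) 1) := by
  have hN := r.five_le
  rw [← sw_particle_left a k hk (by omega)]
  refine fastest_neut r ?_ ?_ (fun j hj => ?_) ?_
  · rw [occ_fam]; omega
  · rw [occ_fam]; omega
  · simp only [Gain, Iface, occ_fam] at hj; omega
  · simp only [Neut, Iface, occ_fam]; omega

theorem Passage.of_fastest {x y : Config N} (hx : Passage x) (h : Fastest κ μL μR x y) :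
    Trap y ∨ Passage y := by
  have hN := r.five_le
  cases hx with
  | insert c h1 h2 =>
    obtain rfl := h.eq_fl r (by rw [occ_fam]; omega) (by rw [occ_fam]; omega)
    rw [fl_fam c]
    by_cases hc : c + 2 = N
    · exact Or.inl (Or.inr (Or.inl (by congr 1; omega)))
    · exact Or.inl (Or.inl ⟨c + 1, by omega, by omega, Or.inl rfl⟩)
  | hole a c h1 h2 h3 h4 =>
    have o1 : Occ (fam N a 1 c) 1 := by rw [occ_fam]; omega
    have oN : ¬ Occ (fam N a 1 c) N := by rw [occ_fam]; omega
    by_cases ha : a = 1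
    · subst ha
      obtain ⟨k, hk, rfl⟩ := h.eq_gain r o1 oN (j := 1) (by simp only [Gain, Iface, occ_fam]; omega)
      have : k = 1 ∨ k = 1 + 1 ∧ c = 1 := by
        simp only [Gain, Iface, occ_fam] at hk; omega
      rcases this with rfl | ⟨rfl, rfl⟩
      · rw [sw_hole_left _ _ le_rfl]
        exact Or.inr (.insert _ (by omega) (by omega))
      · rw [sw_hole_right _ _ le_rfl (by omega)]
        have : fam N (1 + 1) 1 (1 - 1) = eta N 2 := by
          refine ext_occ fun n _ _ => ?_
          simp only [occ_fam, occ_eta]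
          omega
        rw [this]
        exact Or.inr (.pair hN)
    · have hg : ∀ j, ¬ Gain j (fam N a 1 c) := fun j hj => by
        simp only [Gain, Iface, occ_fam] at hj; omega
      obtain ⟨k, hk, rfl⟩ := h.eq_neut r o1 oN hg (j := a)
        (by simp only [Neut, Iface, occ_fam]; omega)
      have : k = a ∨ k = a + 1 := by
        simp only [Neut, Iface, occ_fam] at hk; omega
      rcases this with rfl | rfl
      · rw [sw_hole_left _ _ h1]
        exact trap_or_passage_hole (by omega) (by omega) (by omega)
      · rw [sw_hole_right _ _ h2 (by omega)]
        exact trap_or_passage_hole (by omega) (by omega) (by omega)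
  | particle a k h1 h2 h3 =>
    have hg : ∀ j, ¬ Gain j (fam N a k 1) := fun j hj => by
      simp only [Gain, Iface, occ_fam] at hj; omega
    obtain ⟨j, hj, rfl⟩ := h.eq_neut r (by rw [occ_fam]; omega) (by rw [occ_fam]; omega) hg
      (j := a + k) (by simp only [Neut, Iface, occ_fam]; omega)
    have : j = a + k ∨ j = a + k + 1 := by
      simp only [Neut, Iface, occ_fam] at hj; omega
    rcases this with rfl | rfl
    · rw [sw_particle_left _ _ h2 (by omega)]
      exact trap_or_passage_particle hN h1 (by omega) (by omega)
    · rw [sw_particle_right _ _ (by omega)]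
      exact trap_or_passage_particle hN h1 (by omega) (by omega)
  | remove _ =>
    obtain rfl := (fastest_fr_eta r le_rfl (by omega)).1 h
    exact Or.inr (.pair hN)
  | pair _ =>
    have h2 := h.2 _ (fastest_pair r).1
    have h3 := (loss_eta (N := N) (p := 2) le_rfl (by omega)).phi (κ := κ) (μL := μL) (μR := μR)
    rw [sw_eta (by omega) (by omega)] at h3
    rw [h3] at h2
    have := r.pos
    rcases eta_cases r le_rfl (by omega) h.1 with ⟨-, rfl, -⟩ | h | rfl
    · exact trap_or_passage_hole le_rfl le_rfl (by omega)
    · linarith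
    · exact Or.inr (.remove hN)

theorem Passage.exists_phi {x : Config N} (hx : Passage x) :
    ∃ y, Allowed x y ∧ -(κ / 2) ≤ phi κ μL μR x y := by
  have hN := r.five_le
  have hκ := r.pos
  cases hx with
  | insert c h1 h2 =>
    exact ⟨_, allowed_fl _, by linarith [lt_phi_fl r (x := fam N 0 1 c) (by rw [occ_fam]; omega)]⟩
  | hole a c h1 h2 h3 h4 =>
    have hi : Iface a (fam N a 1 c) := by simp only [Iface, occ_fam]; omega
    refine ⟨_, allowed_sw hi, ?_⟩
    rcases hi.cases with h | h | h <;> rw [h.phi] <;> linarith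
  | particle a k h1 h2 h3 =>
    have hi : Iface a (fam N a k 1) := by simp only [Iface, occ_fam]; omega
    refine ⟨_, allowed_sw hi, ?_⟩
    rcases hi.cases with h | h | h <;> rw [h.phi] <;> linarith
  | remove _ =>
    refine ⟨_, (allowed_fr _).symm, ?_⟩
    rw [phi_fr_eta r (by omega)]
    linarith [r.right]
  | pair _ =>
    have hl := loss_eta (N := N) (p := 2) le_rfl (by omega)
    exact ⟨_, allowed_sw hl.1, hl.phi.ge⟩

variable (hv : IsRate κ μL μR v)
include hv

omit r in
theorem Reach.of_fastest {ℓ : ℝ} {x y z : Config N} (hx : Live κ μL μR v ℓ x)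
    (h : Fastest κ μL μR x y) (hy : Live κ μL μR v ℓ y → Reach κ μL μR v ℓ y z) :
    Reach κ μL μR v ℓ x z :=
  (hx.edge h).reach.trans (hy ((hx.edge h).live hv))

/-- The hole of a packed block moves to the left and is filled there. -/
theorem reach_of_hole {ℓ : ℝ} {a c : ℕ} (ha : 1 ≤ a) (hc : 1 ≤ c) (h2 : a = 1 ∨ 2 ≤ c)
    (h : a + c + 2 ≤ N) (hl : Live κ μL μR v ℓ (fam N a 1 c)) :
    Reach κ μL μR v ℓ (fam N a 1 c) (eta N (a + c + 1)) := by
  induction a, ha using Nat.le_induction generalizing c with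
  | base =>
    refine Reach.of_fastest hv hl (fastest_hole r le_rfl hc h2 h) fun hl' => ?_
    have := (hl'.edge (fastest_insert r (by omega))).reach
    rwa [show c + 1 + 1 = 1 + c + 1 by omega] at this
  | succ a ha ih =>
    refine Reach.of_fastest hv hl (fastest_hole r (by omega) hc h2 h) fun hl' => ?_
    have := ih (c := c + 1) (by omega) (by omega) (by omega) hl'
    rwa [show a + (c + 1) + 1 = a + 1 + c + 1 by omega] at this

theorem reach_of_particle {ℓ : ℝ} {a k : ℕ} (ha : 2 ≤ a) (hk : 1 ≤ k)
    (h : a + k + 2 ≤ N) (hl : Live κ μL μR v ℓ (fam N a k 1)) :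
    Reach κ μL μR v ℓ (fam N a k 1) (fam N a 1 1) := by
  induction k, hk using Nat.le_induction with
  | base => exact Relation.ReflTransGen.refl
  | succ k hk ih =>
    exact Reach.of_fastest hv hl (fastest_particle r ha (by omega) h) (ih (by omega))

theorem Passage.reach {ℓ : ℝ} {x : Config N} (hx : Passage x) (hl : Live κ μL μR v ℓ x) :
    ∃ w, Trap w ∧ Reach κ μL μR v ℓ x w := by
  have hN := r.five_le
  have hη : ∀ p, 3 ≤ p → p + 1 ≤ N → Trap (eta N p) := fun p h1 h2 => by
    by_cases hp : p + 1 = N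
    · exact Or.inr (Or.inl (by congr 1; omega))
    · exact Or.inl ⟨p, h1, by omega, Or.inl rfl⟩
  have hpair : Live κ μL μR v ℓ (eta N 2) → Reach κ μL μR v ℓ (eta N 2) (eta N 3) := fun hl =>
    Reach.of_fastest hv hl (fastest_pair r)
      (reach_of_hole r hv (c := 1) le_rfl le_rfl (Or.inl rfl) (by omega))
  cases hx with
  | insert c h1 h2 =>
    exact ⟨_, hη _ (by omega) (by omega), (hl.edge (fastest_insert r h2)).reach⟩
  | hole a c h1 h2 h3 h4 =>
    exact ⟨_, hη _ (by omega) (by omega), reach_of_hole r hv h1 h2 h3 h4 hl⟩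
  | particle a k h1 h2 h3 =>
    exact ⟨_, Or.inl ⟨a + 1, by omega, by omega, Or.inr (Or.inl rfl)⟩,
      reach_of_particle r hv h1 (by omega) h3 hl⟩
  | remove _ =>
    exact ⟨_, hη 3 le_rfl (by omega), Reach.of_fastest hv hl
      ((fastest_fr_eta r le_rfl (by omega)).2 rfl) hpair⟩
  | pair _ => exact ⟨_, hη 3 le_rfl (by omega), hpair hl⟩

end Kawasaki

namespace Kawasaki

variable {N : ℕ} [NeZero N] {κ μL μR : ℝ} {v : Config N → ℝ} (r : Regime N κ μL μR)
  (hv : IsRate κ μL μR v)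
include r hv

theorem rate_fam_le {p : ℕ} (hp : 3 ≤ p) (hpN : p + 2 ≤ N) :
    v (fam N (p - 1) 1 1) + κ ≤ v (eta N p) := by
  have hl := loss_eta (N := N) (p := p) (by omega) (by omega)
  have hφ := hl.gain_sw.phi (κ := κ) (μL := μL) (μR := μR)
  have hA := (allowed_sw hl.1).symm
  rw [sw_sw hl.1, sw_eta (by omega) (by omega)] at hφ
  rw [sw_eta (by omega) (by omega)] at hA
  have := (Edge.live (ℓ := v (fam N (p - 1) 1 1) + κ / 2) hv ⟨hA, by rw [hφ]⟩).le
    fun u hu => phi_eta_le r (by omega) hpN hu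
  linarith

theorem rate_fr_eta_lt {p : ℕ} (hp : 3 ≤ p) (hpN : p + 2 ≤ N) : v (fr (eta N p)) < -κ := by
  have := (Edge.live (ℓ := v (fr (eta N p)) - μR / 2) hv
    ⟨(allowed_fr _).symm, by rw [phi_fr_eta r hpN]; linarith⟩).le
    fun u hu => phi_eta_le r (by omega) hpN hu
  linarith [r.right, hv.nonpos (eta N p)]

/-- The ways to leave the core of a packed configuration. -/
theorem Core.exit {ℓ : ℝ} {p : ℕ} {a b : Config N} (hp : 3 ≤ p) (hpN : p + 2 ≤ N)
    (ha : Core p a) (hb : ¬ Core p b) (hab : Edge κ μL μR v ℓ a b) (hℓ : -κ ≤ ℓ) :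
    (ℓ ≤ v (fam N (p - 1) 1 1) ∧ (b = fam N (p - 2) 1 2 ∨ b = fam N (p - 1) 2 1)) ∨
      ℓ < -(κ / 2) ∧ p + 2 = N ∧ b = eta N (N - 1) := by
  have hκ := r.pos
  have h1 := rate_fam_le r hv hp hpN
  have h2 := rate_fr_eta_lt r hv hp hpN
  have h3 := hv.nonpos (eta N p)
  obtain ⟨hA, hle⟩ := hab
  simp only [Core, not_or] at hb
  rcases ha with rfl | rfl | rfl
  · rcases eta_cases r (by omega) (by omega) hA with h | h | h
    · exact absurd h.2.1 hb.2.1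
    · linarith
    · exact absurd h hb.2.2
  · rcases core_cases r hp hpN hA with h | h | ⟨h, h'⟩
    · exact absurd h hb.1
    · linarith
    · exact Or.inl ⟨by linarith, h'⟩
  · rcases fr_eta_cases r (by omega) hpN hA with h | h | ⟨h, h'⟩
    · exact absurd h hb.1
    · linarith
    · exact Or.inr ⟨by linarith, h'⟩

/-- The two fullest packed configurations are only left towards the core below them. -/
theorem full_exit {ℓ : ℝ} {a b : Config N} (ha : a = eta N (N - 1) ∨ a = eta N N)
    (hb : b ≠ eta N (N - 1) ∧ b ≠ eta N N) (hab : Edge κ μL μR v ℓ a b) (hℓ : -κ ≤ ℓ) :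
    b = fr (eta N (N - 2)) := by
  have hN := r.five_le
  have hκ := r.pos
  obtain ⟨hA, hle⟩ := hab
  have hn := hv.nonpos a
  rcases ha with rfl | rfl
  · rcases eta_cases r (by omega) (by omega) hA with h | h | h
    · rw [h.2.1, fam_eq_fr (by omega)]
    · linarith
    · exact absurd (h.trans (fr_eta_pred (by omega))) hb.2
  · rcases eta_cases r (by omega) le_rfl hA with h | h | h
    · omega
    · linarith
    · rw [← fr_eta_pred (by omega), fr_fr] at h
      exact absurd h hb.1

theorem Trap.exit {ℓ : ℝ} {a b : Config N} (ha : Trap a) (hb : ¬ Trap b)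
    (hab : Edge κ μL μR v ℓ a b) (hℓ : -κ ≤ ℓ) : ℓ ≤ -κ ∧ Passage b := by
  have hN := r.five_le
  rcases ha with ⟨p, hp, hpN, ha⟩ | ha
  · rcases Core.exit r hv hp hpN ha (fun h => hb (Or.inl ⟨p, hp, hpN, h⟩)) hab hℓ with
      ⟨h1, h2⟩ | ⟨-, -, rfl⟩
    · refine ⟨by linarith [rate_fam_le r hv hp hpN, hv.nonpos (eta N p)], ?_⟩
      rcases h2 with rfl | rfl
      · exact (trap_or_passage_hole (by omega) (by omega) (by omega)).resolve_left hb
      · exact (trap_or_passage_particle hN (by omega) (by omega) (by omega)).resolve_left hb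
    · exact absurd (Or.inr (Or.inl rfl)) hb
  · have hb' : b ≠ eta N (N - 1) ∧ b ≠ eta N N :=
      ⟨fun h => hb (Or.inr (Or.inl h)), fun h => hb (Or.inr (Or.inr h))⟩
    have := full_exit r hv ha hb' hab hℓ
    exact absurd (Or.inl ⟨N - 2, by omega, by omega, Or.inr (Or.inr this)⟩) hb

theorem Passage.level_le {ℓ : ℝ} {x : Config N} (hx : Passage x) (ht : ¬ Trap x)
    (hl : Live κ μL μR v ℓ x) : ℓ ≤ -κ := by
  by_contra hℓ
  obtain ⟨w, hw, hr⟩ := hx.reach r hv hl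
  obtain ⟨a, ha, b, hb, hab⟩ := (hr.symm hv).exists_exit (A := {z | Trap z}) hw ht
  exact hℓ (Trap.exit r hv ha hb hab (not_le.1 hℓ).le).1

/-- Traps and passages are not left at level `-κ`. -/
theorem trap_or_passage_of_edge {a b : Config N} (ha : Trap a ∨ Passage a)
    (hab : Edge κ μL μR v (-κ) a b) : Trap b ∨ Passage b := by
  by_cases ht : Trap a
  · by_cases hb : Trap b
    · exact Or.inl hb
    · exact Or.inr (Trap.exit r hv ht hb hab le_rfl).2
  · have hp := ha.resolve_left ht
    refine hp.of_fastest r ⟨hab.1, fun u hu => ?_⟩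
    have := hp.level_le r hv (ℓ := v a + phi κ μL μR a u) ht ⟨u, hu, le_rfl⟩
    linarith [hab.2]

theorem trap_or_passage_of_reach {a b : Config N} (ha : Trap a ∨ Passage a)
    (hab : Reach κ μL μR v (-κ) a b) : Trap b ∨ Passage b := by
  induction hab with
  | refl => exact ha
  | tail _ h ih => exact trap_or_passage_of_edge r hv ih h

theorem rate_eta_pred_ne : v (eta N (N - 1)) ≠ 0 := by
  intro h0
  have hN := r.five_le
  have hκ := r.pos
  have hl := loss_eta (N := N) (p := N - 1) (by omega) (by omega)
  have hE : Edge κ μL μR v (-(κ / 2)) (eta N (N - 1)) (fr (eta N (N - 2))) := by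
    have hA := allowed_sw hl.1
    have hφ := hl.phi (κ := κ) (μL := μL) (μR := μR)
    rw [sw_eta (by omega) (by omega), fam_eq_fr (by omega)] at hA hφ
    exact ⟨hA, by rw [hφ, h0, zero_add]⟩
  have hnc : ¬ Core (N - 2) (eta N (N - 1)) := by
    have o1 : Occ (eta N (N - 1)) (N - 1) := by rw [occ_eta]; omega
    have o2 : Occ (eta N (N - 1)) (N - 2) := by rw [occ_eta]; omega
    rintro (h | h | h)
    · rw [h, occ_eta] at o1; omega
    · rw [h, occ_fam] at o2; omega
    · rw [h, occ_fr_of_ne _ (by omega), occ_eta] at o1; omega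
  obtain ⟨a, ha, b, hb, hab⟩ := (hE.reach.symm hv).exists_exit (A := {z | Core (N - 2) z})
    (Or.inr (Or.inr rfl)) hnc
  rcases Core.exit r hv (by omega) (by omega) ha hb hab (by linarith) with ⟨h, -⟩ | ⟨h, -⟩
  · linarith [rate_fam_le r hv (p := N - 2) (by omega) (by omega), hv.nonpos (eta N (N - 2))]
  · linarith

theorem rate_eta_full_ne : v (eta N N) ≠ 0 := by
  intro h0
  have hN := r.five_le
  have o : Occ (eta N N) N := by rw [occ_eta]; omega
  have hφ := phi_fr_gt r o
  have hE : Edge κ μL μR v (phi κ μL μR (eta N N) (fr (eta N N))) (eta N N) (eta N (N - 1)) := by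
    have hA := allowed_fr (eta N N)
    have e : fr (eta N N) = eta N (N - 1) := by rw [← fr_eta_pred (by omega), fr_fr]
    rw [e] at hA ⊢
    exact ⟨hA, by rw [h0, zero_add]⟩
  have := (hE.live hv).le fun u hu => phi_eta_pred_le r hu
  linarith [hv.nonpos (eta N (N - 1))]

/-- Configurations of maximal rate are packed. -/
theorem memD_of_eq_zero {x : Config N} (hx : v x = 0) : memD x := by
  have hκ := r.pos
  obtain ⟨p, hp, hpN, -, hr⟩ := exists_eta r hv hx
  have hW := trap_or_passage_of_reach r hv (Or.inl (Or.inl ⟨p, hp, hpN, Or.inl rfl⟩)) (hr.symm hv)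
  by_cases ht : Trap x
  · rcases ht with ⟨p, hp, hpN, rfl | rfl | rfl⟩ | rfl | rfl
    · exact ⟨p, N - p, hp, by omega, by omega, rfl⟩
    · linarith [rate_fam_le r hv hp hpN, hv.nonpos (eta N p)]
    · linarith [rate_fr_eta_lt r hv hp hpN]
    · exact absurd hx (rate_eta_pred_ne r hv)
    · exact absurd hx (rate_eta_full_ne r hv)
  · have hp := hW.resolve_left ht
    obtain ⟨y, hA, hy⟩ := hp.exists_phi r
    linarith [hp.level_le r hv ht (ℓ := -(κ / 2)) ⟨y, hA, by linarith⟩]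

/-- A packed configuration reached at level `-κ` from far away has maximal rate. -/
theorem rate_eta_eq_zero {x : Config N} {p : ℕ} (hp : 3 ≤ p) (hpN : p + 2 ≤ N) (hc : ¬ Core p x)
    (hx : p + 2 = N → x ≠ eta N (N - 1) ∧ x ≠ eta N N)
    (hr : Reach κ μL μR v (-κ) x (eta N p)) : v (eta N p) = 0 := by
  have h1 := rate_fam_le r hv hp hpN
  have hn := hv.nonpos (eta N p)
  obtain ⟨a, ha, b, hb, hab⟩ := (hr.symm hv).exists_exit
    (A := {z | Core p z ∨ p + 2 = N ∧ (z = eta N (N - 1) ∨ z = eta N N)}) (Or.inl (Or.inl rfl))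
    (by simp only [Set.mem_ofPred_eq]; tauto)
  simp only [Set.mem_ofPred_eq, not_or, not_and] at ha hb
  rcases ha with ha | ⟨hpN', ha⟩
  · rcases Core.exit r hv hp hpN ha hb.1 hab le_rfl with ⟨h, -⟩ | ⟨-, h, h'⟩
    · linarith
    · exact absurd h' (hb.2 h).1
  · have := full_exit r hv ha (hb.2 hpN') hab le_rfl
    obtain rfl : p = N - 2 := by omega
    exact absurd (Or.inr (Or.inr this)) hb.1

omit r hv [NeZero N] in
theorem stable_eta {p : ℕ} (hp : 3 ≤ p) (hpN : p + 2 ≤ N) : Stable (eta N p) where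
  first := by rw [occ_eta]; omega
  last := by rw [occ_eta]; omega
  pred := by rw [occ_eta]; omega
  loss j hj := by
    obtain ⟨rfl, -, -⟩ := iface_eta.1 hj
    exact loss_eta (by omega) (by omega)
  block i := by simp only [occ_eta]; omega
  gap i := by simp only [occ_eta]; omega

theorem rate_eta_down {p : ℕ} (hp : 3 ≤ p) (hpN : p + 3 ≤ N) (h0 : v (eta N (p + 1)) = 0) :
    v (eta N p) = 0 := by
  obtain ⟨-, hr, -, -⟩ := emission r hv (stable_eta (by omega) (by omega)) h0 (l := p + 1)
    (by rw [occ_eta]; omega) (fun n hn => by rw [occ_eta]; omega)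
  have e : erase (p + 1) (eta N (p + 1)) = eta N p := by
    refine ext_occ fun n _ _ => ?_
    simp only [occ_erase, occ_eta]
    omega
  rw [e] at hr
  refine rate_eta_eq_zero r hv hp (by omega) ?_ (by omega) hr
  have o1 : Occ (eta N (p + 1)) (p + 1) := by rw [occ_eta]; omega
  have o2 : Occ (eta N (p + 1)) p := by rw [occ_eta]; omega
  rintro (h | h | h)
  · rw [h, occ_eta] at o1; omega
  · rw [h, occ_fam] at o2; omega
  · rw [h, occ_fr_of_ne _ (by omega), occ_eta] at o1; omega

theorem rate_eta_up {p : ℕ} (hp : 3 ≤ p) (hpN : p + 3 ≤ N) (h0 : v (eta N p) = 0) :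
    v (eta N (p + 1)) = 0 := by
  have hκ := r.pos
  have hl := loss_eta (N := N) (p := p) (by omega) (by omega)
  have hE : Edge κ μL μR v (-(κ / 2)) (eta N p) (fam N (p - 1) 1 1) := by
    have hA := allowed_sw hl.1
    have hφ := hl.phi (κ := κ) (μL := μL) (μR := μR)
    rw [sw_eta (by omega) (by omega)] at hA hφ
    exact ⟨hA, by rw [hφ, h0, zero_add]⟩
  have hlow := (hE.live hv).le (phi_le_half r (by rw [occ_fam]; omega) (by rw [occ_fam]; omega))
  have hE2 : Edge κ μL μR v (-κ) (fam N (p - 1) 1 1) (fam N (p - 2) 1 2) := by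
    have hn : Neut (p - 1) (fam N (p - 1) 1 1) := by
      simp only [Neut, Iface, occ_fam]; omega
    have hA := allowed_sw hn.1
    have hφ := hn.phi (κ := κ) (μL := μL) (μR := μR)
    rw [sw_hole_left _ _ (by omega)] at hA hφ
    exact ⟨hA, by rw [show p - 2 = p - 1 - 1 by omega, hφ]; linarith⟩
  have hr := (hE.mono (ℓ' := -κ) (by linarith)).reach.trans (hE2.reach.trans
    (reach_of_hole r hv (by omega) (by omega) (by omega) (by omega) (hE2.live hv)))
  rw [show p - 2 + 2 + 1 = p + 1 by omega] at hr
  have o1 : ¬ Occ (eta N p) (p + 1) := by rw [occ_eta]; omega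
  have o2 : ¬ Occ (eta N p) (p + 2) := by rw [occ_eta]; omega
  refine rate_eta_eq_zero r hv (by omega) (by omega) ?_ (fun _ => ⟨fun h => ?_, fun h => ?_⟩) hr
  · rintro (h | h | h)
    · rw [h, occ_eta] at o1; omega
    · rw [h, occ_fam] at o2; omega
    · rw [h, occ_fr_of_ne _ (by omega), occ_eta] at o1; omega
  · rw [h, occ_eta] at o1; omega
  · rw [h, occ_eta] at o1; omega

theorem rate_eq_zero_iff {x : Config N} : v x = 0 ↔ memD x := by
  refine ⟨memD_of_eq_zero r hv, ?_⟩
  rintro ⟨p, q, hp, hq, hpq, rfl⟩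
  obtain ⟨x₀, h₀⟩ := hv.exists_eq_zero
  obtain ⟨p₀, hp₀, hp₀N, h₀, -⟩ := exists_eta r hv h₀
  have h3 : v (eta N 3) = 0 := by
    induction p₀, hp₀ using Nat.le_induction with
    | base => exact h₀
    | succ k hk ih => exact ih (by omega) (rate_eta_down r hv hk (by omega) h₀)
  have hpN : p + 2 ≤ N := by omega
  clear hq hpq
  induction p, hp using Nat.le_induction with
  | base => exact h3
  | succ k hk ih => exact rate_eta_up r hv hk (by omega) (ih (by omega))

end Kawasaki

open Kawasaki Filter in
/-- low-temperature asymptotics of the stationary distribution of the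
boundary driven Kawasaki process for `μ_L > κ > 0 > μ_R`, `|μ_R| > κ`:
the states with `(1/β) log ρ_β(x) → 0` are exactly the `η_{p,q}` with
`p ≥ 3, q ≥ 2, p+q = N`; every other state has `(1/β) log ρ_β(x) → -α` for some `α > 0`. -/
theorem statement0 (N : ℕ) [NeZero N] (hN : 5 ≤ N) (κ μL μR : ℝ)
    (hκ : 0 < κ) (hμL : κ < μL) (hμR : μR < 0) (hμRκ : κ < |μR|)
    (ρ : ℝ → Config N → ℝ)
    (hρ : ∀ β : ℝ, 0 < β → IsStationary κ μL μR β (ρ β)) :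
    (∀ x : Config N,
      Tendsto (fun β : ℝ => Real.log (ρ β x) / β) atTop (nhds 0) ↔ memD x) ∧
    (∀ x : Config N, ¬ memD x →
      ∃ α : ℝ, 0 < α ∧
        Tendsto (fun β : ℝ => Real.log (ρ β x) / β) atTop (nhds (-α))) := by
  have r : Regime N κ μL μR := ⟨hN, hκ, hμL, by rwa [abs_of_neg hμR] at hμRκ⟩
  obtain ⟨v, hv, hlim⟩ := exists_isRate (by omega) κ μL μR ρ hρ
  refine ⟨fun x => ?_, fun x hx => ⟨-v x, ?_, by simpa using hlim x⟩⟩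
  · rw [← rate_eq_zero_iff r hv]
    exact ⟨fun h => tendsto_nhds_unique (hlim x) h, fun h => h ▸ hlim x⟩
  · have := mt (rate_eq_zero_iff r hv).1 hx
    exact neg_pos.2 (lt_of_le_of_ne (hv.nonpos x) this)
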